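/- arXiv:1211.2614 — 2 statements merged into one kernel-verified Lean document; each statement's English description precedes it below -/
import Mathlib

section
/- Let p and q be primes with p dividing q−1, and let G be a finite non-abelian group of order pq (the group F_pq, unique up to isomorphism). Then D(G) = 2q. -/
/-- The set of all products of the terms of the multiset `S` taken in some order. -/
def prodSet {G : Type*} [Group G] (S : Multiset G) : Set G :=
  {g | ∃ l : List G, (l : Multiset G) = S ∧ l.prod = g}

/-- A sequence (multiset) over `G` is a product-one sequence if its terms can be
ordered so that their product is `1`. -/
def IsProductOne {G : Type*} [Group G] (S : Multiset G) : Prop :=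
  (1 : G) ∈ prodSet S

/-- A minimal product-one sequence (atom): a nontrivial product-one sequence that cannot
be partitioned into two nontrivial product-one subsequences. -/
def IsMinimalProductOne {G : Type*} [Group G] (S : Multiset G) : Prop :=
  S ≠ 0 ∧ IsProductOne S ∧
    ¬ ∃ T₁ T₂ : Multiset G, T₁ ≠ 0 ∧ T₂ ≠ 0 ∧ S = T₁ + T₂ ∧
      IsProductOne T₁ ∧ IsProductOne T₂

/-- The small Davenport constant: the maximal length of a sequence over `G` having
no nontrivial product-one subsequence. -/
noncomputable def smallDavenport (G : Type*) [Group G] : ℕ :=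
  sSup {n | ∃ S : Multiset G, Multiset.card S = n ∧
    ∀ T : Multiset G, T ≤ S → T ≠ 0 → ¬ IsProductOne T}

/-- The large Davenport constant: the maximal length of a minimal product-one sequence. -/
noncomputable def largeDavenport (G : Type*) [Group G] : ℕ :=
  sSup {n | ∃ S : Multiset G, Multiset.card S = n ∧ IsMinimalProductOne S}

/-- Two distinct translates of a nonempty proper subset of `ZMod q` cover more elements. -/
lemma card_lt_of_two_translates {q : ℕ} [Fact q.Prime] {X Z : Finset (ZMod q)} {s t : ZMod q}
    (hX : X.Nonempty) (hXq : X.card < q) (hst : s ≠ t) (hs : ∀ y ∈ X, y + s ∈ Z)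
    (ht : ∀ y ∈ X, y + t ∈ Z) : X.card < Z.card := by
  by_contra! h
  have key : ∀ u : ZMod q, (∀ y ∈ X, y + u ∈ Z) → ∑ z ∈ Z, z = ∑ y ∈ X, y + X.card * u := by
    intro u hu
    have hinj : Set.InjOn (fun y : ZMod q => y + u) X := fun a _ b _ hab => add_right_cancel hab
    have hsub : X.image (fun y => y + u) ⊆ Z := Finset.image_subset_iff.2 hu
    have heq : X.image (fun y => y + u) = Z :=
      Finset.eq_of_subset_of_card_le hsub (by rwa [Finset.card_image_of_injOn hinj])
    rw [← heq, Finset.sum_image hinj, Finset.sum_add_distrib]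
    simp
  have h1 := (key s hs).symm.trans (key t ht)
  have hc : (X.card : ZMod q) ≠ 0 := by
    rw [Ne, ZMod.natCast_eq_zero_iff]
    exact fun hd => absurd (Nat.le_of_dvd hX.card_pos hd) (by omega)
  exact hst (mul_left_cancel₀ hc (add_left_cancel h1))

/-- Reindexing a sum along an affine self-map of a finite set. -/
lemma sum_comp_affine {q : ℕ} [Fact q.Prime] {Y : Finset (ZMod q)} {β v : ZMod q} (hβ : β ≠ 0)
    (hY : ∀ y ∈ Y, β * y + v ∈ Y) (f : ZMod q → ZMod q) :
    ∑ y ∈ Y, f (β * y + v) = ∑ y ∈ Y, f y := by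
  have hinj : Set.InjOn (fun y : ZMod q => β * y + v) Y := fun a _ b _ hab =>
    mul_left_cancel₀ hβ (add_right_cancel hab)
  have heq : Y.image (fun y => β * y + v) = Y :=
    Finset.eq_of_subset_of_card_le (Finset.image_subset_iff.2 hY)
      (by rw [Finset.card_image_of_injOn hinj])
  conv_rhs => rw [← heq]
  rw [Finset.sum_image hinj]

lemma exists_affine_fixed {q : ℕ} [Fact q.Prime] {β : ZMod q} (hβ : β ≠ 1) (v : ZMod q) :
    ∃ w, β * w + v = w := by
  refine ⟨v / (1 - β), ?_⟩
  have : 1 - β ≠ 0 := sub_ne_zero.2 hβ.symm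
  field_simp
  ring

lemma sum_eq_zero_of_rotation {q : ℕ} [Fact q.Prime] {Y : Finset (ZMod q)} {β v w : ZMod q} {j : ℕ}
    (hβ0 : β ≠ 0) (hβ : β ^ j ≠ 1) (hY : ∀ y ∈ Y, β * y + v ∈ Y) (hw : β * w + v = w) :
    ∑ y ∈ Y, (y - w) ^ j = 0 := by
  have h := sum_comp_affine hβ0 hY (fun y => (y - w) ^ j)
  have h2 : ∀ y ∈ Y, (β * y + v - w) ^ j = β ^ j * (y - w) ^ j := by
    intro y _
    rw [← mul_pow]
    congr 1
    linear_combination hw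
  rw [Finset.sum_congr rfl h2, ← Finset.mul_sum] at h
  have : (β ^ j - 1) * ∑ y ∈ Y, (y - w) ^ j = 0 := by linear_combination h
  exact (mul_eq_zero.1 this).resolve_left (sub_ne_zero.2 hβ)

/-- A set invariant under a rotation of order greater than two is not almost invariant under
a translation. -/
lemma rotation_not_almost_translation {q : ℕ} [Fact q.Prime] {Y A : Finset (ZMod q)}
    {β v t : ZMod q} (hβ0 : β ≠ 0) (hβ1 : β ≠ 1) (hβ2 : β ^ 2 ≠ 1)
    (hY : ∀ y ∈ Y, β * y + v ∈ Y) (hA : A ⊆ Y) (ht : t ≠ 0) (hAt : ∀ y ∈ A, y + t ∈ Y)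
    (hYA : Y.card ≤ A.card + 1) (h2 : 2 ≤ Y.card) (hq : Y.card + 2 ≤ q) : False := by
  obtain ⟨B, hBA, hB⟩ := Finset.exists_subset_card_eq (s := A) (n := Y.card - 1) (by omega)
  replace hA := hBA.trans hA
  replace hAt : ∀ y ∈ B, y + t ∈ Y := fun y hy => hAt y (hBA hy)
  obtain ⟨w, hw⟩ := exists_affine_fixed hβ1 v
  have hS1 := sum_eq_zero_of_rotation (j := 1) hβ0 (by simpa using hβ1) hY hw
  have hS2 := sum_eq_zero_of_rotation (j := 2) hβ0 hβ2 hY hw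
  have hmiss : ∀ u : ZMod q, (∀ y ∈ B, y + u ∈ Y) → ∃ o, ∀ j : ℕ,
      ∑ y ∈ B, (y + u - w) ^ j + (o - w) ^ j = ∑ y ∈ Y, (y - w) ^ j := by
    intro u hu
    have hinj : Set.InjOn (fun y : ZMod q => y + u) B := fun a _ b _ hab => add_right_cancel hab
    have hsub : B.image (fun y => y + u) ⊆ Y := Finset.image_subset_iff.2 hu
    have hc : (Y \ B.image (fun y => y + u)).card = 1 := by
      rw [Finset.card_sdiff_of_subset hsub, Finset.card_image_of_injOn hinj]
      omega
    obtain ⟨o, ho⟩ := Finset.card_eq_one.1 hc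
    refine ⟨o, fun j => ?_⟩
    rw [← Finset.sum_sdiff hsub, ho, Finset.sum_image hinj, Finset.sum_singleton, add_comm]
  obtain ⟨o, ho⟩ := hmiss 0 (by simpa using fun y hy => hA hy)
  obtain ⟨o', ho'⟩ := hmiss t hAt
  simp only [add_zero] at ho
  have e2 : ∑ y ∈ B, (y + t - w) ^ 2
      = ∑ y ∈ B, (y - w) ^ 2 + 2 * t * ∑ y ∈ B, (y - w) ^ 1 + B.card * t ^ 2 := by
    rw [Finset.mul_sum, ← nsmul_eq_mul, ← Finset.sum_const, ← Finset.sum_add_distrib,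
      ← Finset.sum_add_distrib]
    exact Finset.sum_congr rfl fun y _ => by ring
  have e1 : ∑ y ∈ B, (y + t - w) ^ 1 = ∑ y ∈ B, (y - w) ^ 1 + B.card * t := by
    rw [← nsmul_eq_mul, ← Finset.sum_const, ← Finset.sum_add_distrib]
    exact Finset.sum_congr rfl fun y _ => by ring
  have e3 : ∑ y ∈ B, (y + t - w) ^ 3 = ∑ y ∈ B, (y - w) ^ 3 + 3 * t * ∑ y ∈ B, (y - w) ^ 2
      + 3 * t ^ 2 * ∑ y ∈ B, (y - w) ^ 1 + B.card * t ^ 3 := by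
    rw [Finset.mul_sum, Finset.mul_sum, ← nsmul_eq_mul, ← Finset.sum_const,
      ← Finset.sum_add_distrib, ← Finset.sum_add_distrib, ← Finset.sum_add_distrib]
    exact Finset.sum_congr rfl fun y _ => by ring
  have a1 := ho 1
  have a2 := ho 2
  have a3 := ho 3
  have b1 := ho' 1
  have b2 := ho' 2
  have b3 := ho' 3
  rw [e1] at b1
  rw [e2] at b2
  rw [e3] at b3
  rw [hS1] at a1 b1
  rw [hS2] at a2 b2
  rw [← a3] at b3
  generalize ∑ y ∈ B, (y - w) ^ 1 = A1 at *
  generalize ∑ y ∈ B, (y - w) ^ 2 = A2 at *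
  generalize ∑ y ∈ B, (y - w) ^ 3 = A3 at *
  generalize o - w = r at *
  generalize o' - w = r' at *
  obtain ⟨m, hm⟩ : ∃ m : ZMod q, m = (B.card : ZMod q) := ⟨_, rfl⟩
  have hnat : ∀ k : ℕ, 0 < k → k < q → (k : ZMod q) ≠ 0 := fun k hk hkq h =>
    absurd (Nat.le_of_dvd hk ((ZMod.natCast_eq_zero_iff k q).1 h)) (by omega)
  have m0 : m ≠ 0 := hm ▸ hnat _ (by omega) (by omega)
  have m1 : m + 1 ≠ 0 := by
    have := hnat (B.card + 1) (by omega) (by omega)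
    rw [hm]
    exact_mod_cast this
  have m2 : m + 2 ≠ 0 := by
    have := hnat (B.card + 2) (by omega) (by omega)
    rw [hm]
    exact_mod_cast this
  rw [← hm] at b1 b2 b3
  simp only [pow_one] at a1 b1
  have hA1 : A1 = -r := by linear_combination a1
  have hA2 : A2 = -r ^ 2 := by linear_combination a2
  have hr' : r' = r - m * t := by linear_combination b1 - a1
  subst hA1 hA2 hr'
  have c1 : (m + 1) * t * (m * t - 2 * r) = 0 := by linear_combination b2
  have c2 : m * t = 2 * r :=
    sub_eq_zero.1 ((mul_eq_zero.1 c1).resolve_left (mul_ne_zero m1 ht))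
  have c3 : t ^ 3 * (m * ((m + 1) * (m + 2))) = 0 := by
    linear_combination (-4) * b3 + (-3*m*t*(m*t-2*r) + 3*t*(m*t+2*r) + 6*t^2) * c2
  exact (mul_ne_zero (pow_ne_zero 3 ht) (mul_ne_zero m0 (mul_ne_zero m1 m2))) c3

/-- A set invariant under a rotation of prime order `p` that contains a point other than the
centre has at least `p` elements. -/
lemma le_card_of_rotation {p q : ℕ} [Fact q.Prime] (hp : p.Prime) {Y : Finset (ZMod q)}
    {β v y : ZMod q} (hβ : β ≠ 1) (hβp : β ^ p = 1) (hY : ∀ y ∈ Y, β * y + v ∈ Y)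
    (hy : y ∈ Y) (hyv : β * y + v ≠ y) : p ≤ Y.card := by
  obtain ⟨w, hw⟩ := exists_affine_fixed hβ v
  have hmem : ∀ i : ℕ, w + β ^ i * (y - w) ∈ Y := by
    intro i
    induction i with
    | zero => simpa using hy
    | succ i ih =>
      convert hY _ ih using 1
      linear_combination (-1) * hw
  have hyw : y - w ≠ 0 := fun h => hyv (by rw [sub_eq_zero.1 h, hw])
  have : Fact p.Prime := ⟨hp⟩
  have hord : orderOf β = p := orderOf_eq_prime hβp hβ
  have := Finset.card_le_card_of_injOn (s := Finset.range p) (t := Y)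
    (fun i => w + β ^ i * (y - w)) (fun i _ => hmem i) (fun i hi j hj hij => by
      have h := mul_right_cancel₀ hyw (add_left_cancel hij)
      refine pow_injOn_Iio_orderOf ?_ ?_ h <;> rw [hord]
      · simpa using hi
      · simpa using hj)
  simpa using this

/-- Coordinates identifying a group with a group of affine maps `y ↦ χ g * y + x g` of
`ZMod q` whose linear parts are `p`-th roots of unity. -/
structure AffineCoords (G : Type*) [Group G] (p q : ℕ) where
  χ : G →* ZMod q
  x : G → ZMod q
  x_mul : ∀ g h, x (g * h) = x g + χ g * x h
  ext : ∀ g h, χ g = χ h → x g = x h → g = h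
  χ_pow : ∀ g, χ g ^ p = 1
  exists_χ_ne_one : ∃ τ, χ τ ≠ 1
  exists_translation : ∃ α, χ α = 1 ∧ x α = 1

namespace AffineCoords

variable {G : Type*} [Group G] {p q : ℕ} [Fact q.Prime] (A : AffineCoords G p q)

/-- The common linear part of all products of the terms of `T`. -/
def lin (T : Multiset G) : ZMod q := (T.map A.χ).prod

open Classical in
/-- The translation parts of the products of the terms of `T`. -/
noncomputable def trans (T : Multiset G) : Finset (ZMod q) :=
  {y | ∃ l : List G, (l : Multiset G) = T ∧ A.x l.prod = y}

lemma mem_trans {T : Multiset G} {y : ZMod q} :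
    y ∈ A.trans T ↔ ∃ l : List G, (l : Multiset G) = T ∧ A.x l.prod = y := by
  simp [trans]

lemma x_one : A.x 1 = 0 := by
  have := A.x_mul 1 1
  simpa using this

lemma χ_ne_zero (g : G) : A.χ g ≠ 0 := by
  intro h
  have := map_mul A.χ g g⁻¹
  rw [mul_inv_cancel, map_one, h, zero_mul] at this
  exact one_ne_zero this

lemma eq_one_iff {g : G} : g = 1 ↔ A.χ g = 1 ∧ A.x g = 0 := by
  constructor
  · rintro rfl
    exact ⟨map_one _, A.x_one⟩
  · rintro ⟨h1, h2⟩
    exact A.ext _ _ (by simpa using h1) (by simpa [A.x_one] using h2)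

@[simp] lemma lin_zero : A.lin 0 = 1 := by simp [lin]

@[simp] lemma lin_add (S T : Multiset G) : A.lin (S + T) = A.lin S * A.lin T := by simp [lin]

@[simp] lemma lin_singleton {q : ℕ} (A : AffineCoords G p q) (a : G) :
    A.lin {a} = A.χ a := by simp [lin]

lemma lin_coe (l : List G) : A.lin l = A.χ l.prod := by simp [lin, map_list_prod]

lemma lin_ne_zero (T : Multiset G) : A.lin T ≠ 0 := by
  induction T using Quotient.inductionOn with
  | _ l =>
    rw [Multiset.quot_mk_to_coe, lin_coe]
    exact A.χ_ne_zero _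

lemma lin_pow (T : Multiset G) : A.lin T ^ p = 1 := by
  induction T using Quotient.inductionOn with
  | _ l =>
    rw [Multiset.quot_mk_to_coe, lin_coe]
    exact A.χ_pow _

lemma isProductOne_iff {T : Multiset G} : IsProductOne T ↔ A.lin T = 1 ∧ 0 ∈ A.trans T := by
  rw [mem_trans]
  constructor
  · rintro ⟨l, rfl, hl⟩
    exact ⟨by rw [lin_coe, hl, map_one], l, rfl, by rw [hl, A.x_one]⟩
  · rintro ⟨h1, l, rfl, hl⟩
    exact ⟨l, rfl, A.eq_one_iff.2 ⟨by rw [← lin_coe, h1], hl⟩⟩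

@[simp] lemma trans_zero : A.trans 0 = {0} := by
  ext y
  simp [mem_trans, A.x_one, eq_comm]

@[simp] lemma trans_singleton (a : G) : A.trans {a} = {A.x a} := by
  ext y
  simp [mem_trans, eq_comm]

lemma trans_nonempty (T : Multiset G) : (A.trans T).Nonempty := by
  induction T using Quotient.inductionOn with
  | _ l => exact ⟨A.x l.prod, A.mem_trans.2 ⟨l, rfl, rfl⟩⟩

lemma add_mem_trans {S T : Multiset G} {y z : ZMod q} (hy : y ∈ A.trans S)
    (hz : z ∈ A.trans T) : y + A.lin S * z ∈ A.trans (S + T) := by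
  obtain ⟨l, rfl, rfl⟩ := A.mem_trans.1 hy
  obtain ⟨l', rfl, rfl⟩ := A.mem_trans.1 hz
  exact A.mem_trans.2 ⟨l ++ l', by simp, by rw [List.prod_append, A.x_mul, lin_coe]⟩

lemma add_mem_trans' {S T : Multiset G} {y z : ZMod q} (hy : y ∈ A.trans S)
    (hz : z ∈ A.trans T) : z + A.lin T * y ∈ A.trans (S + T) :=
  add_comm S T ▸ A.add_mem_trans hz hy

lemma card_trans_le_add (S T : Multiset G) : (A.trans S).card ≤ (A.trans (S + T)).card := by
  obtain ⟨z, hz⟩ := A.trans_nonempty T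
  refine Finset.card_le_card_of_injOn (fun y => y + A.lin S * z)
    (fun y hy => A.add_mem_trans hy hz) fun a _ b _ hab => add_right_cancel hab

lemma card_trans_mono {S T : Multiset G} (h : S ≤ T) : (A.trans S).card ≤ (A.trans T).card := by
  obtain ⟨U, rfl⟩ := Multiset.le_iff_exists_add.1 h
  exact A.card_trans_le_add S U

lemma trans_eq_univ_of_le_card {T : Multiset G} (h : q ≤ (A.trans T).card) :
    A.trans T = Finset.univ := by
  apply Finset.eq_univ_of_card
  have := (A.trans T).card_le_univ
  rw [ZMod.card] at this ⊢
  omega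

lemma card_trans_le (T : Multiset G) : (A.trans T).card ≤ q := by
  have := (A.trans T).card_le_univ
  rwa [ZMod.card] at this

/-- A product-one proper subsequence whose complement has all products in its coset splits off. -/
lemma not_isMinimalProductOne {R Y T : Multiset G} (hR0 : R ≠ 0) (hR : IsProductOne R)
    (hT : T ≤ Y) (hTq : q ≤ (A.trans T).card) : ¬ IsMinimalProductOne (R + Y) := by
  rintro ⟨-, h1, h2⟩
  have hY : q ≤ (A.trans Y).card := hTq.trans (A.card_trans_mono hT)
  refine h2 ⟨R, Y, hR0, ?_, rfl, hR, A.isProductOne_iff.2 ⟨?_, ?_⟩⟩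
  · rintro rfl
    have := (Fact.out : q.Prime).two_le
    simp at hY
    omega
  · have a := (A.isProductOne_iff.1 h1).1
    rwa [lin_add, (A.isProductOne_iff.1 hR).1, one_mul] at a
  · rw [A.trans_eq_univ_of_le_card hY]
    exact Finset.mem_univ _

/-- Cyclic rotations of a product with trivial linear part. -/
lemma rotate_mem_trans {l l' : List G} (h : A.lin ((l ++ l' : List G) : Multiset G) = 1) :
    (A.χ l.prod)⁻¹ * A.x (l ++ l').prod ∈ A.trans ((l ++ l' : List G) : Multiset G) := by
  refine A.mem_trans.2 ⟨l' ++ l, Multiset.coe_eq_coe.2 List.perm_append_comm, ?_⟩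
  rw [lin_coe, List.prod_append, map_mul] at h
  rw [List.prod_append, List.prod_append, A.x_mul, A.x_mul]
  have := A.χ_ne_zero l.prod
  field_simp
  linear_combination A.x l.prod * h

open Classical in
/-- The maximal abelian subgroup containing a nontrivial element, encoded by `none` for
translations and by the fixed point for the other elements. -/
noncomputable def cls (g : G) : Option (ZMod q) :=
  if A.χ g = 1 then none else some (A.x g / (1 - A.χ g))

lemma cls_eq_none_iff {g : G} : A.cls g = none ↔ A.χ g = 1 := by
  simp [cls]

lemma cls_eq_some_iff {g : G} {κ : ZMod q} :
    A.cls g = some κ ↔ A.χ g ≠ 1 ∧ A.x g = κ * (1 - A.χ g) := by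
  by_cases h : A.χ g = 1
  · simp [cls, h]
  · have : 1 - A.χ g ≠ 0 := sub_ne_zero.2 (Ne.symm h)
    simp [cls, h, div_eq_iff this]

lemma not_commute_of_cls_ne {a b : G} (ha : a ≠ 1) (hb : b ≠ 1) (h : A.cls a ≠ A.cls b) :
    A.x a + A.χ a * A.x b ≠ A.x b + A.χ b * A.x a := by
  have hx : ∀ g : G, g ≠ 1 → A.χ g = 1 → A.x g ≠ 0 := fun g hg h1 h0 =>
    hg (A.eq_one_iff.2 ⟨h1, h0⟩)
  intro heq
  by_cases h1 : A.χ a = 1 <;> by_cases h2 : A.χ b = 1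
  · exact h (by rw [A.cls_eq_none_iff.2 h1, A.cls_eq_none_iff.2 h2])
  · have : A.x a * (1 - A.χ b) = 0 := by rw [h1] at heq; linear_combination heq
    exact mul_ne_zero (hx a ha h1) (sub_ne_zero.2 (Ne.symm h2)) this
  · have : A.x b * (1 - A.χ a) = 0 := by rw [h2] at heq; linear_combination -heq
    exact mul_ne_zero (hx b hb h2) (sub_ne_zero.2 (Ne.symm h1)) this
  · have e1 : 1 - A.χ a ≠ 0 := sub_ne_zero.2 (Ne.symm h1)
    have e2 : 1 - A.χ b ≠ 0 := sub_ne_zero.2 (Ne.symm h2)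
    apply h
    simp only [cls, h1, h2, if_false, Option.some.injEq]
    rw [div_eq_div_iff e1 e2]
    linear_combination heq

end AffineCoords

section Lists

lemma Multiset.exists_le_card_eq {α : Type*} {T : Multiset α} {n : ℕ} (h : n ≤ T.card) :
    ∃ R ≤ T, R.card = n := by
  induction T using Quotient.inductionOn with
  | _ l => exact ⟨(l.take n : List α), (List.take_sublist n l).subperm, by simpa using h⟩

variable {G : Type*} [Group G]

/-- A list with at least as many terms as there are possible partial products has a contiguous
block with product one. -/
lemma exists_block_prod_eq_one (l : List G) (V : Finset G)
    (hV : ∀ i ≤ l.length, (l.take i).prod ∈ V) (h : V.card ≤ l.length) :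
    ∃ l₁ l₂ l₃ : List G, l = l₁ ++ l₂ ++ l₃ ∧ l₂ ≠ [] ∧ l₂.prod = 1 := by
  obtain ⟨i, hi, j, hj, hij, heq⟩ := Finset.exists_ne_map_eq_of_card_lt_of_maps_to
    (s := Finset.range (l.length + 1)) (t := V) (f := fun i => (l.take i).prod)
    (by simpa using Nat.lt_succ_of_le h)
    (fun i hi => hV i (by simpa [Nat.lt_succ_iff] using hi))
  wlog hlt : i < j generalizing i j
  · exact this j hj i hi hij.symm heq.symm (by omega)
  simp only [Finset.mem_range, Nat.lt_succ_iff] at hi hj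
  have e : l.take j = l.take i ++ (l.take j).drop i := by
    conv_lhs => rw [← List.take_append_drop i (l.take j)]
    rw [List.take_take, Nat.min_eq_left hlt.le]
  refine ⟨l.take i, (l.take j).drop i, l.drop j, ?_, ?_, ?_⟩
  · rw [← e, List.take_append_drop]
  · intro h0
    have := congrArg List.length h0
    simp at this
    omega
  · change (l.take i).prod = (l.take j).prod at heq
    rw [e, List.prod_append] at heq
    simpa using heq

/-- A minimal product-one sequence, ordered with product one, has no proper contiguous block
with product one. -/
lemma IsMinimalProductOne.block_ne_one {l₁ l₂ l₃ : List G}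
    (h : IsMinimalProductOne ((l₁ ++ l₂ ++ l₃ : List G) : Multiset G))
    (h1 : (l₁ ++ l₂ ++ l₃).prod = 1) (h2 : l₂ ≠ []) (h3 : l₁ ++ l₃ ≠ []) : l₂.prod ≠ 1 := by
  intro h4
  refine h.2.2 ⟨(l₂ : Multiset G), ((l₁ ++ l₃ : List G) : Multiset G), by simpa using h2,
    by simpa using h3, ?_, ⟨l₂, rfl, h4⟩, ⟨l₁ ++ l₃, rfl, ?_⟩⟩
  · rw [Multiset.coe_add, Multiset.coe_eq_coe]
    rw [← List.append_assoc]
    exact List.perm_append_comm.append_right _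
  · simpa [h4] using h1

/-- Sufficiently many elements of a finite submonoid contain a short product-one subsequence. -/
lemma exists_le_isProductOne (T : Multiset G) (V : Submonoid G) [Finite V] {n : ℕ}
    (hn : Nat.card V ≤ n) (hT : ∀ g ∈ T, g ∈ V) (h : n ≤ T.card) :
    ∃ R ≤ T, R ≠ 0 ∧ IsProductOne R ∧ R.card ≤ n := by
  classical
  obtain ⟨T', hT', hc⟩ := Multiset.exists_le_card_eq h
  obtain ⟨l, rfl⟩ := Quotient.exists_rep T'
  have : (V : Set G).Finite := Set.toFinite _
  obtain ⟨l₁, l₂, l₃, rfl, h2, h3⟩ := exists_block_prod_eq_one l this.toFinset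
    (fun i _ => by
      simp only [Set.Finite.mem_toFinset, SetLike.mem_coe]
      exact Submonoid.list_prod_mem _ fun g hg =>
        hT g (Multiset.mem_of_le hT' (by simpa using List.mem_of_mem_take hg)))
    (by
      rw [← Set.ncard_eq_toFinset_card _ this, ← Nat.card_coe_set_eq]
      simpa using hn.trans_eq hc.symm)
  refine ⟨l₂, le_trans ?_ hT', by simpa using h2, ⟨l₂, rfl, h3⟩, ?_⟩
  · exact ((List.sublist_append_right _ _).trans (List.sublist_append_left _ _)).subperm
  · rw [← hc]
    simp
    omega

end Lists

lemma sq_ne_one_of_pow_eq_one {M : Type*} [Monoid M] {p : ℕ} (hp : p.Prime) (hp2 : p ≠ 2) {β : M}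
    (hβ : β ^ p = 1) (h1 : β ≠ 1) : β ^ 2 ≠ 1 := by
  intro h
  have : Fact p.Prime := ⟨hp⟩
  have hord := orderOf_eq_prime hβ h1
  have := orderOf_dvd_of_pow_eq_one h
  rw [hord] at this
  exact hp2 ((Nat.prime_dvd_prime_iff_eq hp Nat.prime_two).1 this)

/-- A set contained with two distinct translates in a set that is larger by at most one
is not invariant under a rotation of order greater than two. -/
lemma not_rotation_of_two_translates {q : ℕ} [Fact q.Prime] {X Z : Finset (ZMod q)}
    {β v s t : ZMod q} (hβ0 : β ≠ 0) (hβ1 : β ≠ 1) (hβ2 : β ^ 2 ≠ 1)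
    (hX : ∀ y ∈ X, β * y + v ∈ X) (hst : s ≠ t) (hs : ∀ y ∈ X, y + s ∈ Z)
    (ht : ∀ y ∈ X, y + t ∈ Z) (hZ : Z.card ≤ X.card + 1) (h2 : 2 ≤ X.card)
    (hq : X.card + 2 ≤ q) : False := by
  refine rotation_not_almost_translation (A := {y ∈ X | y + (s - t) ∈ X}) (t := s - t)
    hβ0 hβ1 hβ2 hX (Finset.filter_subset _ _) (sub_ne_zero.2 hst)
    (fun y hy => (Finset.mem_filter.1 hy).2) ?_ h2 hq
  have hinj : Set.InjOn (fun y : ZMod q => y + s) {y ∈ X | y + (s - t) ∉ X} :=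
    fun a _ b _ hab => add_right_cancel hab
  have hinj' : Set.InjOn (fun y : ZMod q => y + t) X := fun a _ b _ hab => add_right_cancel hab
  have hdisj : Disjoint (({y ∈ X | y + (s - t) ∉ X} : Finset (ZMod q)).image (fun y => y + s))
      (X.image (fun y => y + t)) := by
    rw [Finset.disjoint_left]
    rintro _ hy0 hy'
    obtain ⟨y, hy, rfl⟩ := Finset.mem_image.1 hy0
    obtain ⟨e, he, heq⟩ := Finset.mem_image.1 hy'
    replace hy := (Finset.mem_filter.1 hy).2
    apply hy
    convert he using 1
    linear_combination -heq
  have hsub : ({y ∈ X | y + (s - t) ∉ X} : Finset (ZMod q)).image (fun y => y + s) ∪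
      X.image (fun y => y + t) ⊆ Z :=
    Finset.union_subset
      (Finset.image_subset_iff.2 fun y hy => hs y (Finset.filter_subset _ _ hy))
      (Finset.image_subset_iff.2 ht)
  have hc := Finset.card_le_card hsub
  rw [Finset.card_union_of_disjoint hdisj, Finset.card_image_of_injOn (by simp),
    Finset.card_image_of_injOn hinj'] at hc
  have := Finset.card_filter_add_card_filter_not (s := X) (fun y => y + (s - t) ∈ X)
  omega

namespace AffineCoords

variable {G : Type*} [Group G] {p q : ℕ} [Fact q.Prime] (A : AffineCoords G p q)

lemma translate_mem_trans {T : Multiset G} {a b : G} {y : ZMod q} (hy : y ∈ A.trans T) :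
    y + A.lin T * (A.x a + A.χ a * A.x b) ∈ A.trans (T + ({a} + {b})) := by
  refine A.add_mem_trans hy ?_
  have := A.add_mem_trans (S := {a}) (T := {b}) (y := A.x a) (z := A.x b) (by simp) (by simp)
  simpa using this

lemma translate_mem_trans' {T : Multiset G} {a b : G} {y : ZMod q} (hy : y ∈ A.trans T) :
    y + A.lin T * (A.x b + A.χ b * A.x a) ∈ A.trans (T + ({a} + {b})) :=
  add_comm ({a} : Multiset G) {b} ▸ A.translate_mem_trans hy

lemma card_trans_add_singleton_le (T : Multiset G) (a b : G) :
    (A.trans (T + {a})).card ≤ (A.trans (T + ({a} + {b}))).card := by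
  rw [← add_assoc]
  exact A.card_trans_le_add _ _

/-- Appending a noncommuting pair enlarges the set of products. -/
lemma card_lt_card_trans_add_pair {T : Multiset G} {a b : G} (ha : a ≠ 1) (hb : b ≠ 1)
    (hab : A.cls a ≠ A.cls b) (hT : (A.trans T).card < q) :
    (A.trans T).card < (A.trans (T + ({a} + {b}))).card := by
  refine card_lt_of_two_translates (A.trans_nonempty T) hT ?_
    (fun y hy => A.translate_mem_trans hy) (fun y hy => A.translate_mem_trans' hy)
  exact fun h => A.not_commute_of_cls_ne ha hb hab (mul_left_cancel₀ (A.lin_ne_zero T) h)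

/-- Appending a noncommuting pair adds at least two products, unless there are very few or very
many products already. -/
lemma card_add_two_le_card_trans_add_pair (hp : p.Prime) (hp2 : p ≠ 2) {T : Multiset G} {a b : G}
    (ha : a ≠ 1) (hb : b ≠ 1) (hab : A.cls a ≠ A.cls b) (h2 : 2 ≤ (A.trans T).card)
    (hT : (A.trans T).card + 3 ≤ q) :
    (A.trans T).card + 2 ≤ (A.trans (T + ({a} + {b}))).card := by
  wlog hβ : A.χ b ≠ 1 generalizing a b
  · rw [not_not] at hβ
    rw [add_comm ({a} : Multiset G)]
    refine this hb ha hab.symm fun h => hab ?_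
    rw [A.cls_eq_none_iff.2 h, A.cls_eq_none_iff.2 hβ]
  by_contra! hlt
  have hne : A.lin T * (A.x a + A.χ a * A.x b) ≠ A.lin T * (A.x b + A.χ b * A.x a) :=
    fun h => A.not_commute_of_cls_ne ha hb hab (mul_left_cancel₀ (A.lin_ne_zero T) h)
  have hrot : ∀ (g : G) (v : ZMod q), A.χ g ≠ 1 →
      ¬ ∀ y ∈ A.trans T, A.χ g * y + v ∈ A.trans T := fun g v hg h =>
    not_rotation_of_two_translates (A.χ_ne_zero g) hg
      (sq_ne_one_of_pow_eq_one hp hp2 (A.χ_pow g) hg) h hne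
      (fun y hy => A.translate_mem_trans hy) (fun y hy => A.translate_mem_trans' hy)
      (by omega) h2 (by omega)
  have himage : ∀ g : G, (A.trans (T + {g})).card = (A.trans T).card →
      A.trans (T + {g}) = (A.trans T).image (fun y => y + A.lin T * A.x g) := by
    intro g hg
    refine (Finset.eq_of_subset_of_card_le (Finset.image_subset_iff.2 fun y hy =>
      A.add_mem_trans hy (by simp)) ?_).symm
    rw [Finset.card_image_of_injOn (fun a _ b _ hab => add_right_cancel hab), hg]
  have hrot' : ∀ g : G, (A.trans (T + {g})).card = (A.trans T).card → A.χ g = 1 := by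
    intro g hg
    by_contra hg1
    refine hrot g (A.x g - A.lin T * A.x g) hg1 fun y hy => ?_
    have h := A.add_mem_trans' (T := {g}) hy (by simp : A.x g ∈ A.trans {g})
    rw [himage g hg, Finset.mem_image] at h
    obtain ⟨e, he, heq⟩ := h
    rw [lin_singleton] at heq
    convert he using 1
    linear_combination -heq
  have hle := A.card_trans_le_add T {a}
  have hle' := A.card_trans_add_singleton_le T a b
  obtain h1 | h1 : (A.trans (T + {a})).card = (A.trans T).card ∨
      (A.trans (T + {a})).card = (A.trans T).card + 1 := by omega
  · have hα := hrot' a h1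
    have hy0 : A.x a ≠ 0 := fun h => ha (A.eq_one_iff.2 ⟨hα, h⟩)
    have hc : A.lin T = 1 := by
      by_contra hc
      have := card_lt_of_two_translates (Z := A.trans (T + {a})) (A.trans_nonempty T) (by omega)
        (s := A.lin T * A.x a) (t := A.x a)
        (fun h => hc (mul_right_cancel₀ hy0 (by rw [h, one_mul])))
        (fun y hy => A.add_mem_trans hy (by simp)) (fun y hy => by
          have := A.add_mem_trans' (T := {a}) hy (by simp : A.x a ∈ A.trans {a})
          rwa [lin_singleton, hα, one_mul, add_comm (A.x a)] at this)
      omega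
    have hb1 : (A.trans (T + {b})).card ≠ (A.trans T).card := fun h => hβ (hrot' b h)
    have hle2 := A.card_trans_le_add T {b}
    have hle2' := A.card_trans_add_singleton_le T b a
    rw [add_comm ({b} : Multiset G)] at hle2'
    have := card_lt_of_two_translates (Z := A.trans (T + {b} + {a})) (A.trans_nonempty (T + {b}))
      (by omega) (s := A.lin (T + {b}) * A.x a) (t := A.x a)
      (fun h => hβ (by
        rw [lin_add, hc, one_mul, lin_singleton] at h
        exact mul_right_cancel₀ hy0 (by rw [h, one_mul])))
      (fun y hy => A.add_mem_trans hy (by simp)) (fun y hy => by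
        have := A.add_mem_trans' (T := {a}) hy (by simp : A.x a ∈ A.trans {a})
        rwa [lin_singleton, hα, one_mul, add_comm (A.x a)] at this)
    rw [add_assoc, add_comm ({b} : Multiset G)] at this
    omega
  · have heq : (A.trans (T + {a})).image (fun y => y + A.lin (T + {a}) * A.x b) =
        A.trans (T + ({a} + {b})) := by
      rw [← add_assoc]
      refine Finset.eq_of_subset_of_card_le (Finset.image_subset_iff.2 fun y hy =>
        A.add_mem_trans hy (by simp)) ?_
      rw [Finset.card_image_of_injOn (fun a _ b _ hab => add_right_cancel hab), add_assoc]
      omega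
    refine rotation_not_almost_translation
      (Y := A.trans (T + ({a} + {b})))
      (A := (A.trans T).image (fun y => y + A.lin T * (A.x a + A.χ a * A.x b)))
      (β := A.χ b) (v := A.x b - A.χ b * (A.lin (T + {a}) * A.x b))
      (A.χ_ne_zero b) hβ (sq_ne_one_of_pow_eq_one hp hp2 (A.χ_pow b) hβ) ?_
      (Finset.image_subset_iff.2 fun y hy => A.translate_mem_trans hy)
      (sub_ne_zero.2 hne.symm) ?_ ?_ (by omega) (by omega)
    · intro y hy
      rw [← heq] at hy
      obtain ⟨e, he, rfl⟩ := Finset.mem_image.1 hy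
      have := A.add_mem_trans' (T := {b}) he (by simp : A.x b ∈ A.trans {b})
      rw [lin_singleton, add_assoc] at this
      convert this using 1
      ring
    · intro y hy
      obtain ⟨e, he, rfl⟩ := Finset.mem_image.1 hy
      convert A.translate_mem_trans' he using 1
      ring
    · rw [Finset.card_image_of_injOn (fun a _ b _ hab => add_right_cancel hab)]
      omega

/-- The sum of the entries of a list of pairs, as a multiset. -/
def ofPairs {G : Type*} (ps : List (G × G)) : Multiset G :=
  (ps.map fun r => ({r.1} + {r.2} : Multiset G)).sum

/-- The pairs consist of nontrivial elements of different classes. -/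
def Good (ps : List (G × G)) : Prop :=
  ∀ r ∈ ps, r.1 ≠ 1 ∧ r.2 ≠ 1 ∧ A.cls r.1 ≠ A.cls r.2

lemma min_le_card_trans_add_pairs (hp : p.Prime) (hp2 : p ≠ 2) (hq : q ≠ 2) {N : ℕ} (hN : 2 ≤ N)
    (hN2 : Even N) {T : Multiset G} (hT : min q N ≤ (A.trans T).card) {ps : List (G × G)}
    (hps : A.Good ps) : min q (N + 2 * ps.length) ≤ (A.trans (T + ofPairs ps)).card := by
  have hodd : ¬ Even q := fun h => hq (((Fact.out : q.Prime).even_iff).1 h)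
  induction ps generalizing T N with
  | nil => simpa [ofPairs] using hT
  | cons r ps ih =>
    have hr := hps r (by simp)
    have h1 := A.card_trans_le_add T ({r.1} + {r.2})
    have h2 : (A.trans T).card < q →
      (A.trans T).card < (A.trans (T + ({r.1} + {r.2}))).card :=
      A.card_lt_card_trans_add_pair hr.1 hr.2.1 hr.2.2
    have h3 : 2 ≤ (A.trans T).card → (A.trans T).card + 3 ≤ q →
      (A.trans T).card + 2 ≤ (A.trans (T + ({r.1} + {r.2}))).card :=
      A.card_add_two_le_card_trans_add_pair hp hp2 hr.1 hr.2.1 hr.2.2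
    have h4 := A.card_trans_le T
    have h5 := (Fact.out : q.Prime).two_le
    have := ih (N := N + 2) (by omega) (by simpa [Nat.even_add] using hN2)
      (T := T + ({r.1} + {r.2})) (by
        rw [Nat.even_iff] at hodd hN2
        omega)
      (fun s hs => hps s (by simp [hs]))
    rw [show T + ofPairs (r :: ps) = T + ({r.1} + {r.2}) + ofPairs ps by
      simp [ofPairs, add_assoc]]
    rw [List.length_cons]
    convert this using 2
    ring

lemma min_le_card_trans_pairs (hp : p.Prime) (hp2 : p ≠ 2) (hq : q ≠ 2) {ps : List (G × G)}
    (hps : A.Good ps) : min q (2 * ps.length) ≤ (A.trans (ofPairs ps)).card := by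
  cases ps with
  | nil => simp
  | cons r ps =>
    have hr := hps r (by simp)
    have h := A.card_lt_card_trans_add_pair (T := 0) hr.1 hr.2.1 hr.2.2
      (by simpa using (Fact.out : q.Prime).one_lt)
    have := A.min_le_card_trans_add_pairs hp hp2 hq (N := 2) le_rfl even_two
      (T := {r.1} + {r.2}) (by simp at h ⊢; omega) (ps := ps) (fun s hs => hps s (by simp [hs]))
    rw [show ofPairs (r :: ps) = {r.1} + {r.2} + ofPairs ps by simp [ofPairs]]
    rw [List.length_cons]
    convert this using 2
    ring

end AffineCoords

/-- Disjoint pairs with different labels can be chosen as long as no label is too popular. -/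
lemma exists_pairs {G κ : Type*} (f : G → κ) [DecidableEq κ] (t : ℕ) (Y : Multiset G)
    (hY : 2 * t ≤ Y.card) (h : ∀ k, t ≤ Y.countP (fun y => f y ≠ k)) :
    ∃ ps : List (G × G), ps.length = t ∧ AffineCoords.ofPairs ps ≤ Y ∧ ∀ r ∈ ps, f r.1 ≠ f r.2 := by
  classical
  induction t generalizing Y with
  | zero => exact ⟨[], by simp [AffineCoords.ofPairs]⟩
  | succ t ih =>
    have hne : Y.toFinset.Nonempty := by
      rw [Finset.nonempty_iff_ne_empty, Ne, Multiset.toFinset_eq_empty]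
      rintro rfl
      simp at hY
    obtain ⟨a, ha, hmax⟩ := Y.toFinset.exists_max_image
      (fun a => Y.countP (fun y => f y = f a)) hne
    rw [Multiset.mem_toFinset] at ha
    obtain ⟨b, hb, hab⟩ := Multiset.countP_pos.1 (lt_of_lt_of_le (Nat.succ_pos t) (h (f a)))
    obtain ⟨Y', rfl⟩ := Multiset.exists_cons_of_mem ha
    have hb' : b ∈ Y' := by
      refine (Multiset.mem_cons.1 hb).resolve_left ?_
      rintro rfl
      exact hab rfl
    obtain ⟨Z, rfl⟩ := Multiset.exists_cons_of_mem hb'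
    obtain ⟨ps, hl, hle, hps⟩ := ih Z (by simp at hY; omega) (by
      intro k
      have hk := h k
      simp only [ne_eq]
      simp only [ne_eq, Multiset.countP_cons, Multiset.card_cons] at hk hY
      by_cases h1 : f a = k
      · subst h1
        simp only [hab, not_true_eq_false, if_false, not_false_eq_true, if_true] at hk
        omega
      by_cases h2 : f b = k
      · subst h2
        simp only [h1, not_true_eq_false, if_false, not_false_eq_true, if_true] at hk
        omega
      have hin : Z.countP (fun y => f y = k) ≤ Z.countP (fun y => f y = f a) + 1 := by
        by_cases hz : ∃ z ∈ Z, f z = k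
        · obtain ⟨z, hz, rfl⟩ := hz
          have := hmax z (by simp [hz])
          simp only [Multiset.countP_cons, h1, h2, hab, if_false, if_true] at this
          omega
        · push Not at hz
          rw [Multiset.countP_eq_zero.2 hz]
          omega
      have hout : Z.countP (fun y => f y = f a) ≤ Z.countP (fun y => ¬ f y = k) := by
        rw [Multiset.countP_eq_card_filter, Multiset.countP_eq_card_filter]
        refine Multiset.card_le_card (Multiset.monotone_filter_right Z ?_)
        rintro y hy rfl
        exact h1 hy.symm
      simp only [h1, h2, not_false_eq_true, if_true] at hk
      have hadd := Multiset.card_eq_countP_add_countP (fun y => f y = k) Z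
      omega)
    refine ⟨(a, b) :: ps, by simp [hl], ?_, ?_⟩
    · rw [← Multiset.singleton_add, ← Multiset.singleton_add, ← add_assoc]
      simpa [AffineCoords.ofPairs] using hle
    · simpa using ⟨fun h => hab h.symm, fun a b hab => hps (a, b) hab⟩

lemma ofPairs_zip_le {G : Type*} (l l' : List G) :
    AffineCoords.ofPairs (l.zip l') ≤ (l : Multiset G) + (l' : Multiset G) := by
  induction l generalizing l' with
  | nil => simp [AffineCoords.ofPairs]
  | cons a l ih =>
    cases l' with
    | nil => simp [AffineCoords.ofPairs]
    | cons b l' =>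
      have h : AffineCoords.ofPairs ((a, b) :: l.zip l') =
          {a} + {b} + AffineCoords.ofPairs (l.zip l') := by simp [AffineCoords.ofPairs]
      rw [List.zip_cons_cons, h, ← Multiset.cons_coe, ← Multiset.cons_coe, ← Multiset.singleton_add,
        ← Multiset.singleton_add, add_add_add_comm]
      exact add_le_add le_rfl (ih l')

namespace AffineCoords

variable {G : Type*} [Group G] {p q : ℕ} [Fact q.Prime] (A : AffineCoords G p q)

/-- Adding translations to a sequence with nontrivial linear part. -/
lemma min_le_card_trans_add_translations {T hs : Multiset G} (hT : A.lin T ≠ 1)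
    (h1 : ∀ g ∈ hs, g ≠ 1 ∧ A.χ g = 1) :
    min q ((A.trans T).card + hs.card) ≤ (A.trans (T + hs)).card := by
  induction hs using Multiset.induction generalizing T with
  | empty => simp
  | cons a s ih =>
    have ha := h1 a (by simp)
    have hx : A.x a ≠ 0 := fun h => ha.1 (A.eq_one_iff.2 ⟨ha.2, h⟩)
    have := ih (T := T + {a}) (by simpa [ha.2] using hT) fun g hg => h1 g (by simp [hg])
    have hlt : (A.trans T).card < q → (A.trans T).card < (A.trans (T + {a})).card := fun h =>
      card_lt_of_two_translates (A.trans_nonempty T) h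
        (s := A.lin T * A.x a) (t := A.x a)
        (fun h => hT (mul_right_cancel₀ hx (by rw [h, one_mul])))
        (fun y hy => A.add_mem_trans hy (by simp)) (fun y hy => by
          have := A.add_mem_trans' (T := {a}) hy (by simp : A.x a ∈ A.trans {a})
          rwa [lin_singleton, ha.2, one_mul, add_comm (A.x a)] at this)
    have := A.card_trans_le_add T {a}
    rw [add_assoc, Multiset.singleton_add] at *
    rw [Multiset.card_cons]
    omega

/-- Adding elements of one class `κ` to a sequence having a product outside of that class. -/
lemma min_le_card_trans_add_class (hp : p.Prime) {T ks : Multiset G} {κ y : ZMod q}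
    (hy : y ∈ A.trans T) (hyκ : y ≠ κ * (1 - A.lin T)) (hks : ∀ g ∈ ks, A.cls g = some κ) :
    min p ((A.trans T).card + ks.card) ≤ (A.trans (T + ks)).card := by
  induction ks using Multiset.induction generalizing T y with
  | empty => simp
  | cons a s ih =>
    obtain ⟨ha, hxa⟩ := A.cls_eq_some_iff.1 (hks a (by simp))
    have := ih (T := T + {a}) (A.add_mem_trans hy (by simp : A.x a ∈ A.trans {a})) (fun h => hyκ (by
      rw [lin_add, lin_singleton, hxa] at h
      linear_combination h)) fun g hg => hks g (by simp [hg])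
    have hle := A.card_trans_le_add T {a}
    have hlt : (A.trans T).card < p → (A.trans T).card < (A.trans (T + {a})).card := by
      intro hX
      by_contra! hle'
      have himage : (A.trans T).image (fun y => y + A.lin T * A.x a) = A.trans (T + {a}) := by
        refine Finset.eq_of_subset_of_card_le (Finset.image_subset_iff.2 fun y hy =>
          A.add_mem_trans hy (by simp)) ?_
        rwa [Finset.card_image_of_injOn (fun a _ b _ hab => add_right_cancel hab)]
      have := le_card_of_rotation hp (Y := A.trans T) (β := A.χ a)
        (v := A.x a - A.lin T * A.x a) (y := y) ha (A.χ_pow a) (fun e he => by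
          have h := A.add_mem_trans' (T := {a}) he (by simp : A.x a ∈ A.trans {a})
          rw [← himage, Finset.mem_image] at h
          obtain ⟨f, hf, heq⟩ := h
          rw [lin_singleton] at heq
          convert hf using 1
          linear_combination -heq) hy (fun h => hyκ (by
            have h1 : 1 - A.χ a ≠ 0 := sub_ne_zero.2 ha.symm
            apply mul_left_cancel₀ h1
            rw [hxa] at h
            linear_combination -h))
      omega
    rw [add_assoc, Multiset.singleton_add] at *
    rw [Multiset.card_cons]
    omega

lemma min_le_card_trans_add (S T : Multiset G) :
    min q ((A.trans S).card + (A.trans T).card - 1) ≤ (A.trans (S + T)).card := by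
  classical
  have hinj : Set.InjOn (fun y : ZMod q => A.lin S * y) (A.trans T) := fun a _ b _ hab =>
    mul_left_cancel₀ (A.lin_ne_zero S) hab
  have h := ZMod.cauchy_davenport Fact.out (A.trans_nonempty S)
    ((A.trans_nonempty T).image (fun y => A.lin S * y))
  rw [Finset.card_image_of_injOn hinj] at h
  refine h.trans (Finset.card_le_card ?_)
  rw [Finset.add_subset_iff]
  rintro y hy _ hz'
  obtain ⟨z, hz, rfl⟩ := Finset.mem_image.1 hz'
  exact A.add_mem_trans hy hz

/-- Sequences dominated by one class `κ`, with sufficiently many terms of other classes. -/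
lemma min_le_card_trans_class (hp : p.Prime) {bs ks : Multiset G} {κ : ZMod q}
    (hbs : ∀ g ∈ bs, g ≠ 1 ∧ A.cls g ≠ some κ) (hks : ∀ g ∈ ks, A.cls g = some κ)
    (hc : ks.card ≤ bs.card * (p - 1)) :
    min q (1 + ks.card) ≤ (A.trans (bs + ks)).card := by
  induction bs using Multiset.induction generalizing ks with
  | empty =>
    have : ks = 0 := by simpa using hc
    simp [this]
  | cons b bs ih =>
    obtain ⟨k₁, hk₁, hc₁⟩ := Multiset.exists_le_card_eq (min_le_left ks.card (p - 1))
    obtain ⟨k₂, rfl⟩ := Multiset.le_iff_exists_add.1 hk₁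
    rw [Multiset.card_cons, add_mul, one_mul] at hc
    rw [Multiset.card_add] at hc hc₁
    have h2 := ih (ks := k₂) (fun g hg => hbs g (by simp [hg])) (fun g hg => hks g (by simp [hg]))
      (by
        rcases le_total (k₁.card + k₂.card) (p - 1) with h | h
        · rw [min_eq_left h] at hc₁
          have : k₂.card = 0 := by omega
          rw [this]
          exact Nat.zero_le _
        · rw [min_eq_right h] at hc₁
          omega)
    obtain ⟨hb1, hbκ⟩ := hbs b (by simp)
    have h1 := A.min_le_card_trans_add_class hp (T := {b}) (ks := k₁) (y := A.x b) (κ := κ)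
      (by simp) (fun h => by
        rw [lin_singleton] at h
        by_cases hχ : A.χ b = 1
        · exact hb1 (A.eq_one_iff.2 ⟨hχ, by rw [h, hχ, sub_self, mul_zero]⟩)
        · exact hbκ (A.cls_eq_some_iff.2 ⟨hχ, h⟩))
      fun g hg => hks g (by simp [hg])
    have h3 := A.min_le_card_trans_add ({b} + k₁) (bs + k₂)
    rw [add_add_add_comm] at h3
    rw [trans_singleton, Finset.card_singleton] at h1
    have := hp.two_le
    rw [Multiset.card_add, ← Multiset.singleton_add]
    omega

open Classical in
/-- A criterion for the products of a sequence to fill a whole coset. -/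
lemma le_card_trans_of_counts (hp : p.Prime) (hp2 : p ≠ 2) (hq2 : q ≠ 2) {Y : Multiset G}
    (hY1 : ∀ g ∈ Y, g ≠ 1) (hY : q + 1 ≤ Y.card) (hN : 2 ≤ Y.countP (fun g => A.χ g ≠ 1))
    (hK : (q + 1) / 2 ≤ Y.countP (fun g => A.χ g ≠ 1) →
      ∀ κ, (q + 1) / 2 ≤ Y.countP (fun g => A.cls g ≠ some κ)) : q ≤ (A.trans Y).card := by
  have hodd : ¬ Even q := fun h => hq2 (((Fact.out : q.Prime).even_iff).1 h)
  rw [Nat.even_iff] at hodd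
  rcases le_or_gt ((q + 1) / 2) (Y.countP (fun g => A.χ g ≠ 1)) with h | h
  · obtain ⟨ps, hl, hle, hps⟩ := exists_pairs A.cls ((q + 1) / 2) Y (by omega) (by
      rintro (_ | κ)
      · simpa only [ne_eq, A.cls_eq_none_iff] using h
      · exact hK h κ)
    refine le_trans ?_ (A.card_trans_mono hle)
    refine le_trans ?_ (A.min_le_card_trans_pairs hp hp2 hq2 (ps := ps) fun r hr => ?_)
    · omega
    · have hr' : ({r.1} + {r.2} : Multiset G) ≤ Y :=
        le_trans (List.single_le_sum (fun _ _ => Multiset.zero_le _) _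
          (List.mem_map_of_mem
          (f := fun r : G × G => ({r.1} + {r.2} : Multiset G)) hr)) hle
      exact ⟨hY1 _ (Multiset.mem_of_le hr' (by simp)), hY1 _ (Multiset.mem_of_le hr' (by simp)),
        hps r hr⟩
  · obtain ⟨lN, hlN⟩ := Quotient.exists_rep (Y.filter (fun g => A.χ g ≠ 1))
    obtain ⟨lH, hlH⟩ := Quotient.exists_rep (Y.filter (fun g => A.χ g = 1))
    have hsplit := Multiset.filter_add_not (fun g => A.χ g = 1) Y
    have hcard := congrArg Multiset.card hsplit
    rw [Multiset.card_add] at hcard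
    rw [Multiset.countP_eq_card_filter] at h hN
    rw [← hlH, ← hlN] at hsplit hcard
    rw [← hlN] at hN h
    change 2 ≤ lN.length at hN
    change lN.length < (q + 1) / 2 at h
    change lH.length + lN.length = _ at hcard
    cases lN with
    | nil => simp at hN
    | cons b bs =>
      rw [List.length_cons] at *
      have hb : ∀ g ∈ b :: bs, A.χ g ≠ 1 ∧ g ≠ 1 := by
        intro g hg
        have : g ∈ Y.filter (fun g => A.χ g ≠ 1) := by rw [← hlN]; simpa using hg
        rw [Multiset.mem_filter] at this
        exact ⟨this.2, hY1 g this.1⟩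
      have hh : ∀ g ∈ lH, g ≠ 1 ∧ A.χ g = 1 := by
        intro g hg
        have : g ∈ Y.filter (fun g => A.χ g = 1) := by rw [← hlH]; simpa using hg
        rw [Multiset.mem_filter] at this
        exact ⟨hY1 g this.1, this.2⟩
      have h1 := A.min_le_card_trans_add_translations (T := {b})
        (hs := ((lH.take (q - 2 * bs.length) : List G) : Multiset G))
        (by simpa using (hb b (by simp)).1) (fun g hg => hh g (List.mem_of_mem_take hg))
      rw [trans_singleton, Finset.card_singleton, Multiset.coe_card, List.length_take,
        Nat.min_eq_left (b := lH.length) (by omega)] at h1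
      have h2 := A.min_le_card_trans_add_pairs hp hp2 hq2 (N := 1 + (q - 2 * bs.length))
        (by omega) (by rw [Nat.even_iff]; omega) h1
        (ps := bs.zip (lH.drop (q - 2 * bs.length))) (by
          rintro ⟨g, g'⟩ hr
          have hg := hb g (List.mem_cons_of_mem _ (List.of_mem_zip hr).1)
          have hg' := hh g' (List.mem_of_mem_drop (List.of_mem_zip hr).2)
          refine ⟨hg.2, hg'.1, fun h => hg.1 ?_⟩
          exact A.cls_eq_none_iff.1 (h.trans (A.cls_eq_none_iff.2 hg'.2)))
      rw [List.length_zip, List.length_drop,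
        Nat.min_eq_left (b := lH.length - _) (by omega)] at h2
      refine le_trans (by omega) (h2.trans (A.card_trans_mono ?_))
      rw [← hsplit]
      refine le_trans (add_le_add le_rfl (ofPairs_zip_le _ _)) ?_
      change _ ≤ ((lH : Multiset G) + ((b :: bs : List G) : Multiset G))
      conv_rhs => rw [← List.take_append_drop (q - 2 * bs.length) lH]
      rw [← Multiset.coe_add, ← Multiset.cons_coe, ← Multiset.singleton_add]
      apply le_of_eq
      abel

open Classical in
/-- The translation parts of the products of subsequences with trivial linear part. -/
noncomputable def subTrans (R : Multiset G) : Finset (ZMod q) :=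
  {y | ∃ T ≤ R, A.lin T = 1 ∧ y ∈ A.trans T}

lemma mem_subTrans {R : Multiset G} {y : ZMod q} :
    y ∈ A.subTrans R ↔ ∃ T ≤ R, A.lin T = 1 ∧ y ∈ A.trans T := by
  simp [subTrans]

lemma zero_mem_subTrans (R : Multiset G) : 0 ∈ A.subTrans R :=
  A.mem_subTrans.2 ⟨0, Multiset.zero_le _, by simp, by simp⟩

lemma card_le_card_trans_of_minimal {U : Multiset G} (hU : A.lin U = 1) (h0 : 0 ∉ A.trans U)
    (hmin : ∀ V ≤ U, V ≠ 0 → A.lin V = 1 → V = U) : U.card ≤ (A.trans U).card := by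
  obtain ⟨l, rfl⟩ := Quotient.exists_rep U
  change A.lin (l : Multiset G) = 1 at hU
  have hv : A.x l.prod ≠ 0 := fun h => h0 (A.mem_trans.2 ⟨l, rfl, h⟩)
  have hmem : ∀ i, (A.χ (l.take i).prod)⁻¹ * A.x l.prod ∈ A.trans (l : Multiset G) := by
    intro i
    have := A.rotate_mem_trans (l := l.take i) (l' := l.drop i)
    rw [List.take_append_drop] at this
    exact this hU
  have := Finset.card_le_card_of_injOn (s := Finset.range l.length)
    (t := A.trans (l : Multiset G)) _ (fun i _ => hmem i) (fun i hi j hj hij => by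
      have heq := inv_injective (mul_right_cancel₀ hv hij)
      simp only [Finset.coe_range, Set.mem_Iio] at hi hj
      by_contra hne
      wlog hlt : i < j generalizing i j
      · exact this j i hij.symm heq.symm hj hi (Ne.symm hne) (by omega)
      have e : l.take j = l.take i ++ (l.take j).drop i := by
        conv_lhs => rw [← List.take_append_drop i (l.take j)]
        rw [List.take_take, Nat.min_eq_left hlt.le]
      rw [e, List.prod_append, map_mul] at heq
      have h1 : A.lin (((l.take j).drop i : List G) : Multiset G) = 1 := by
        rw [lin_coe]
        exact mul_left_cancel₀ (A.χ_ne_zero _) (heq.symm.trans (mul_one _).symm)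
      have h2 := hmin (((l.take j).drop i : List G) : Multiset G)
        ((List.drop_sublist _ _).trans (List.take_sublist _ _)).subperm (by
          rw [Ne, Multiset.coe_eq_zero]
          intro h
          have := congrArg List.length h
          simp at this
          omega) h1
      have := congrArg Multiset.card h2
      change ((l.take j).drop i).length = l.length at this
      simp at this
      omega)
  rw [Finset.card_range] at this
  exact this

open scoped Pointwise in
/-- A sequence with trivial linear part and no product-one subsequence has many subproducts with
trivial linear part. -/
lemma card_lt_card_subTrans {R : Multiset G} (hR : A.lin R = 1)
    (hfree : ∀ T ≤ R, T ≠ 0 → ¬ IsProductOne T) : R.card < (A.subTrans R).card := by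
  classical
  induction hn : R.card using Nat.strong_induction_on generalizing R with
  | _ n ih =>
  subst hn
  by_cases h0 : R = 0
  · subst h0
    simpa using Finset.card_pos.2 ⟨0, A.zero_mem_subTrans 0⟩
  obtain ⟨U, ⟨hUR, hU0, hU⟩, hmin⟩ := (wellFounded_lt (α := Multiset G)).has_min
    {U | U ≤ R ∧ U ≠ 0 ∧ A.lin U = 1} ⟨R, le_rfl, h0, hR⟩
  obtain ⟨R', rfl⟩ := Multiset.le_iff_exists_add.1 hUR
  have hR' : A.lin R' = 1 := by rwa [lin_add, hU, one_mul] at hR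
  have hUpos := Multiset.card_pos.2 hU0
  have h1 := ih R'.card (by rw [Multiset.card_add]; omega) hR'
    (fun T hT => hfree T (hT.trans (Multiset.le_add_left _ _))) rfl
  have h2 := A.card_le_card_trans_of_minimal hU
    (fun h => hfree U hUR hU0 (A.isProductOne_iff.2 ⟨hU, h⟩)) (fun V hV hV0 hV1 =>
      eq_of_le_of_not_lt hV (hmin V ⟨hV.trans hUR, hV0, hV1⟩))
  have h3 := ZMod.cauchy_davenport Fact.out (A.trans_nonempty U) ⟨0, A.zero_mem_subTrans R'⟩
  have hmem : ∀ y ∈ A.trans U + A.subTrans R', ∃ T ≤ U + R', T ≠ 0 ∧ A.lin T = 1 ∧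
      y ∈ A.trans T := by
    intro y hy
    obtain ⟨u, hu, z, hz, rfl⟩ := Finset.mem_add.1 hy
    obtain ⟨T, hT, hT1, hz⟩ := A.mem_subTrans.1 hz
    refine ⟨U + T, add_le_add le_rfl hT, by simp [hU0], by simp [hU, hT1], ?_⟩
    have := A.add_mem_trans hu hz
    rwa [hU, one_mul] at this
  have h0' : (0 : ZMod q) ∉ A.trans U + A.subTrans R' := fun h => by
    obtain ⟨T, hT, hT0, hT1, h⟩ := hmem 0 h
    exact hfree T hT hT0 (A.isProductOne_iff.2 ⟨hT1, h⟩)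
  have h4 : insert 0 (A.trans U + A.subTrans R') ⊆ A.subTrans (U + R') := by
    rw [Finset.insert_subset_iff]
    refine ⟨A.zero_mem_subTrans _, fun y hy => ?_⟩
    obtain ⟨T, hT, -, h⟩ := hmem y hy
    exact A.mem_subTrans.2 ⟨T, hT, h⟩
  have h5 := Finset.card_le_card h4
  rw [Finset.card_insert_of_notMem h0'] at h5
  have h6 := (A.subTrans (U + R')).card_le_univ
  rw [ZMod.card] at h6
  rw [Multiset.card_add]
  omega

lemma exists_isProductOne_of_lin_eq_one {R : Multiset G} (hR : A.lin R = 1) (hq : q ≤ R.card) :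
    ∃ T ≤ R, T ≠ 0 ∧ IsProductOne T := by
  by_contra! h
  have h1 := A.card_lt_card_subTrans hR h
  have h2 := (A.subTrans R).card_le_univ
  rw [ZMod.card] at h2
  omega

end AffineCoords

/-- Three translates of a set with `p - 1` elements cannot be covered by three rotation-invariant
sets of size at most `p` avoiding the centre. -/
lemma not_translates_in_rotation_invariant {p q : ℕ} [Fact q.Prime] (hp : p.Prime) (hpq : p < q)
    {X : Finset (ZMod q)} (hX : p - 1 ≤ X.card) {β : ZMod q} (hβ0 : β ≠ 0) (hβ1 : β ≠ 1)
    (hβ2 : β ^ 2 ≠ 1) (hβp : β ^ p = 1) {s : Fin 3 → ZMod q} (hs : Function.Injective s)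
    {O : Fin 3 → Finset (ZMod q)} (hO0 : ∀ i, 0 ∉ O i) (hOβ : ∀ i, ∀ y ∈ O i, β * y ∈ O i)
    (hOp : ∀ i, (O i).card ≤ p) (hXO : ∀ i, ∀ y ∈ X, y + s i ∈ O i) : False := by
  obtain ⟨B, hBX, hB⟩ := Finset.exists_subset_card_eq hX
  have hp2 := hp.two_le
  have hBne : B.Nonempty := Finset.card_pos.1 (by omega)
  have key : ∀ i, ∃ o, ∑ y ∈ B, y + B.card * s i + o = 0 ∧
      ∑ y ∈ B, y ^ 2 + 2 * s i * ∑ y ∈ B, y + B.card * s i ^ 2 + o ^ 2 = 0 := by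
    intro i
    have hO : ∀ y ∈ O i, β * y + 0 ∈ O i := by simpa using hOβ i
    have hinj : Set.InjOn (fun y : ZMod q => y + s i) B := fun a _ b _ hab => add_right_cancel hab
    have hsub : B.image (fun y => y + s i) ⊆ O i :=
      Finset.image_subset_iff.2 fun y hy => hXO i y (hBX hy)
    obtain ⟨b, hb⟩ := hBne
    have hp_le : p ≤ (O i).card := by
      refine le_card_of_rotation hp hβ1 hβp hO (hXO i b (hBX hb)) fun h => ?_
      have h0 : b + s i ≠ 0 := fun h => hO0 i (h ▸ hXO i b (hBX hb))
      exact hβ1 (mul_right_cancel₀ h0 (by rw [one_mul, ← add_zero (β * _), h]))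
    have hc : (O i \ B.image (fun y => y + s i)).card = 1 := by
      rw [Finset.card_sdiff_of_subset hsub, Finset.card_image_of_injOn hinj]
      have := hOp i
      omega
    obtain ⟨o, ho⟩ := Finset.card_eq_one.1 hc
    have hsum : ∀ j : ℕ, β ^ j ≠ 1 → o ^ j + ∑ y ∈ B, (y + s i) ^ j = 0 := by
      intro j hj
      have := sum_eq_zero_of_rotation (w := 0) hβ0 hj hO (by simp)
      rwa [← Finset.sum_sdiff hsub, ho, Finset.sum_image hinj, Finset.sum_singleton, sub_zero,
        Finset.sum_congr rfl (fun y _ => by rw [sub_zero])] at this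
    have h1 := hsum 1 (by simpa using hβ1)
    have h2 := hsum 2 hβ2
    have e1 : ∑ y ∈ B, (y + s i) ^ 1 = ∑ y ∈ B, y + B.card * s i := by
      rw [← nsmul_eq_mul, ← Finset.sum_const, ← Finset.sum_add_distrib]
      exact Finset.sum_congr rfl fun y _ => by ring
    have e2 : ∑ y ∈ B, (y + s i) ^ 2
        = ∑ y ∈ B, y ^ 2 + 2 * s i * ∑ y ∈ B, y + B.card * s i ^ 2 := by
      rw [Finset.mul_sum, ← nsmul_eq_mul, ← Finset.sum_const, ← Finset.sum_add_distrib,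
        ← Finset.sum_add_distrib]
      exact Finset.sum_congr rfl fun y _ => by ring
    rw [e1] at h1
    rw [e2] at h2
    exact ⟨o, by linear_combination h1, by linear_combination h2⟩
  choose o h1 h2 using key
  have hnat : ∀ k : ℕ, 0 < k → k < q → (k : ZMod q) ≠ 0 := fun k hk hkq h =>
    absurd (Nat.le_of_dvd hk ((ZMod.natCast_eq_zero_iff k q).1 h)) (by omega)
  have hm0 : (B.card : ZMod q) ≠ 0 := hnat _ (by omega) (by omega)
  have hm1 : (B.card : ZMod q) + 1 ≠ 0 := by
    have := hnat (B.card + 1) (by omega) (by omega)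
    exact_mod_cast this
  have hdiff : ∀ i j, i ≠ j →
      2 * ∑ y ∈ B, y + (B.card : ZMod q) * (s i + s j) = 0 := by
    intro i j hij
    have hsij : s i - s j ≠ 0 := sub_ne_zero.2 (hs.ne hij)
    have : (s i - s j) * ((B.card + 1) *
        (2 * ∑ y ∈ B, y + (B.card : ZMod q) * (s i + s j))) = 0 := by
      have a1 := h1 i
      have b1 := h1 j
      have a2 := h2 i
      have b2 := h2 j
      have oi : o i = -(∑ y ∈ B, y + B.card * s i) := by linear_combination a1
      have oj : o j = -(∑ y ∈ B, y + B.card * s j) := by linear_combination b1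
      rw [oi] at a2
      rw [oj] at b2
      linear_combination a2 - b2
    exact (mul_eq_zero.1 ((mul_eq_zero.1 this).resolve_left hsij)).resolve_left hm1
  have e1 := hdiff 0 1 (by decide)
  have e2 := hdiff 0 2 (by decide)
  have : (B.card : ZMod q) * s 1 = B.card * s 2 := by linear_combination e1 - e2
  exact absurd (hs (mul_left_cancel₀ hm0 this)) (by decide)

/-- A list in which every block of terms satisfying `P` has length at most `n`. -/
lemma List.countP_le_of_blocks {α : Type*} (P : α → Bool) (n : ℕ) (l : List α)
    (h : ∀ l₁ l₂ l₃ : List α, l = l₁ ++ l₂ ++ l₃ → (∀ a ∈ l₂, P a) → l₂.length ≤ n) :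
    l.countP P ≤ (l.countP (fun a => !P a) + 1) * n := by
  induction hn : l.length using Nat.strong_induction_on generalizing l with
  | _ k ih =>
  subst hn
  have hsplit := List.takeWhile_append_dropWhile (p := P) (l := l)
  have hpre : ∀ a ∈ l.takeWhile P, P a := fun a ha => List.mem_takeWhile_imp ha
  have h1 := h [] (l.takeWhile P) (l.dropWhile P) (by simp) hpre
  have hc1 : (l.takeWhile P).countP P = (l.takeWhile P).length :=
    List.countP_eq_length.2 hpre
  cases hd : l.dropWhile P with
  | nil =>
    rw [hd, List.append_nil] at hsplit
    rw [hsplit] at hc1 h1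
    rw [hc1, add_mul, one_mul]
    omega
  | cons b r =>
    have hb : P b = false := by
      have := List.head_dropWhile_not P (l := l) (by rw [hd]; simp)
      simpa [hd] using this
    rw [hd] at hsplit
    have hr := ih r.length (by
      rw [← hsplit, List.length_append, List.length_cons]
      omega) r (fun l₁ l₂ l₃ hl hl2 => h (l.takeWhile P ++ b :: l₁) l₂ l₃
        (hsplit.symm.trans (by simp [hl])) hl2) rfl
    rw [← hsplit, List.countP_append, List.countP_append, List.countP_cons, List.countP_cons, hc1,
      hb]
    simp only [Bool.false_eq_true, if_false, Bool.not_false, if_true]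
    nlinarith

lemma IsMinimalProductOne.ne_one {G : Type*} [Group G] {S : Multiset G}
    (hS : IsMinimalProductOne S) (h2 : 2 ≤ S.card) : ∀ g ∈ S, g ≠ 1 := by
  rintro g hg rfl
  obtain ⟨l, rfl, hl⟩ := hS.2.1
  obtain ⟨l₁, l₃, rfl⟩ := List.append_of_mem (Multiset.mem_coe.1 hg)
  have h : l₁ ++ 1 :: l₃ = l₁ ++ [1] ++ l₃ := by simp
  rw [h] at hS hl
  refine hS.block_ne_one hl (by simp) (fun h => ?_) (by simp)
  have := congrArg List.length h
  simp at this h2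
  simp [this] at h2

/-- A minimal product-one sequence over a submonoid is not longer than the submonoid. -/
lemma IsMinimalProductOne.card_le_of_mem {G : Type*} [Group G] {S : Multiset G}
    (hS : IsMinimalProductOne S) (V : Submonoid G) [Finite V] (hV : ∀ g ∈ S, g ∈ V) :
    S.card ≤ Nat.card V := by
  classical
  by_contra! h
  obtain ⟨l, rfl, hl⟩ := hS.2.1
  cases l with
  | nil => simp at h
  | cons a l =>
    have hfin : (V : Set G).Finite := Set.toFinite _
    obtain ⟨l₁, l₂, l₃, rfl, h2, h3⟩ := exists_block_prod_eq_one l hfin.toFinset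
      (fun i _ => by
        simp only [Set.Finite.mem_toFinset, SetLike.mem_coe]
        exact Submonoid.list_prod_mem _ fun g hg =>
          hV g (by simp [List.mem_of_mem_take hg]))
      (by
        rw [← Set.ncard_eq_toFinset_card _ hfin, ← Nat.card_coe_set_eq]
        simp at h ⊢
        omega)
    have e : a :: (l₁ ++ l₂ ++ l₃) = (a :: l₁) ++ l₂ ++ l₃ := by simp
    rw [e] at hS hl
    exact hS.block_ne_one hl h2 (by simp) h3

namespace AffineCoords

variable {G : Type*} [Group G] {p q : ℕ} [Fact q.Prime] (A : AffineCoords G p q)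

/-- The elements fixing the point `κ`. -/
def fixing (κ : ZMod q) : Submonoid G where
  carrier := {g | A.x g = κ * (1 - A.χ g)}
  one_mem' := by simp [A.x_one]
  mul_mem' := by
    intro a b ha hb
    simp only [Set.mem_ofPred_eq] at *
    rw [A.x_mul, ha, hb, map_mul]
    ring

lemma mem_fixing {κ : ZMod q} {g : G} : g ∈ A.fixing κ ↔ A.x g = κ * (1 - A.χ g) := Iff.rfl

lemma fixing_injective (κ : ZMod q) : Function.Injective (fun g : A.fixing κ => A.χ g) := by
  rintro ⟨a, ha⟩ ⟨b, hb⟩ h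
  simp only at h
  rw [mem_fixing] at ha hb
  exact Subtype.ext (A.ext a b h (by rw [ha, hb, h]))

instance (κ : ZMod q) : Finite (A.fixing κ) := Finite.of_injective _ (A.fixing_injective κ)

open Classical in
lemma card_roots_le (hp : p.Prime) (D : Finset (ZMod q)) (hD : ∀ y ∈ D, y ^ p = 1) :
    D.card ≤ p := by
  have : D ⊆ (Polynomial.nthRoots p (1 : ZMod q)).toFinset := fun y hy => by
    rw [Multiset.mem_toFinset, Polynomial.mem_nthRoots hp.pos]
    exact hD y hy
  exact (Finset.card_le_card this).trans
    ((Multiset.toFinset_card_le _).trans (Polynomial.card_nthRoots p 1))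

lemma card_fixing_le (hp : p.Prime) (κ : ZMod q) : Nat.card (A.fixing κ) ≤ p := by
  classical
  have := Fintype.ofFinite (A.fixing κ)
  rw [Nat.card_eq_fintype_card, ← Finset.card_univ,
    ← Finset.card_image_of_injective _ (A.fixing_injective κ)]
  refine card_roots_le hp _ fun y hy => ?_
  obtain ⟨g, -, rfl⟩ := Finset.mem_image.1 hy
  exact A.χ_pow g

lemma translations_injective :
    Function.Injective (fun g : MonoidHom.mker A.χ => A.x g) := by
  rintro ⟨a, ha⟩ ⟨b, hb⟩ h
  simp only at h
  rw [MonoidHom.mem_mker] at ha hb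
  exact Subtype.ext (A.ext a b (by rw [ha, hb]) h)

instance : Finite (MonoidHom.mker A.χ) := Finite.of_injective _ A.translations_injective

lemma card_translations_le : Nat.card (MonoidHom.mker A.χ) ≤ q := by
  have := Nat.card_le_card_of_injective _ A.translations_injective
  rwa [Nat.card_zmod] at this

lemma exists_short_of_translations {T : Multiset G} (hT : ∀ g ∈ T, A.χ g = 1) (h : q ≤ T.card) :
    ∃ R ≤ T, R ≠ 0 ∧ IsProductOne R ∧ R.card ≤ q :=
  exists_le_isProductOne T (MonoidHom.mker A.χ) A.card_translations_le
    (fun g hg => MonoidHom.mem_mker.2 (hT g hg)) h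

lemma exists_short_of_class (hp : p.Prime) {T : Multiset G} {κ : ZMod q}
    (hT : ∀ g ∈ T, A.cls g = some κ) (h : p ≤ T.card) :
    ∃ R ≤ T, R ≠ 0 ∧ IsProductOne R ∧ R.card ≤ p :=
  exists_le_isProductOne T (A.fixing κ) (A.card_fixing_le hp κ)
    (fun g hg => (A.cls_eq_some_iff.1 (hT g hg)).2) h

lemma lin_eq_pow {T : Multiset G} {c : ZMod q} (hT : ∀ g ∈ T, A.χ g = c) :
    A.lin T = c ^ T.card := by
  rw [lin, Multiset.map_congr rfl hT, Multiset.map_const', Multiset.prod_replicate]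

end AffineCoords

lemma card_eq_countP_add_countP_ne {G κ : Type*} [DecidableEq κ] (f : G → κ) (k : κ)
    (Y : Multiset G) :
    Y.card = Y.countP (fun g => f g = k) + Y.countP (fun g => f g ≠ k) :=
  Multiset.card_eq_countP_add_countP _ _

lemma countP_eq_add_countP_ne_le {G κ : Type*} [DecidableEq κ] (f : G → κ) {k k' : κ} (h : k ≠ k')
    (Y : Multiset G) : Y.countP (fun g => f g = k) ≤ Y.countP (fun g => f g ≠ k') := by
  rw [Multiset.countP_eq_card_filter, Multiset.countP_eq_card_filter]
  refine Multiset.card_le_card (Multiset.monotone_filter_right Y ?_)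
  rintro y hy rfl
  exact h hy.symm

namespace AffineCoords

variable {G : Type*} [Group G] {p q : ℕ} [Fact q.Prime] (A : AffineCoords G p q)

/-- A minimal product-one sequence of length at least `2 * q + 1` has many terms that are not
translations. -/
lemma le_countP_χ_ne_one (hp : p.Prime) (hp2 : p ≠ 2) (hq2 : q ≠ 2) {S : Multiset G}
    (hS : IsMinimalProductOne S) (hl : 2 * q + 1 ≤ S.card) (h1 : ∀ g ∈ S, g ≠ 1) :
    (q + 1) / 2 ≤ S.countP (fun g => A.χ g ≠ 1) := by
  by_contra! hlt
  have hq := (Fact.out : q.Prime).two_le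
  have hsplit := Multiset.filter_add_not (fun g => A.χ g = 1) S
  have hcard := card_eq_countP_add_countP_ne A.χ 1 S
  have hlinH : ∀ T : Multiset G, A.lin (T.filter (fun g => A.χ g = 1)) = 1 := fun T => by
    rw [A.lin_eq_pow (fun g hg => (Multiset.mem_filter.1 hg).2), one_pow]
  obtain ⟨R, hR, hR0, hR1, hRq⟩ := A.exists_short_of_translations
    (T := S.filter (fun g => A.χ g = 1)) (fun g hg => (Multiset.mem_filter.1 hg).2)
    (by rw [← Multiset.countP_eq_card_filter]; omega)
  obtain ⟨Y, hY⟩ := Multiset.le_iff_exists_add.1 (hR.trans (Multiset.filter_le _ _))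
  have hRN : R.countP (fun g => A.χ g ≠ 1) = 0 := Multiset.countP_eq_zero.2 fun g hg => by
    simpa using (Multiset.mem_filter.1 (Multiset.mem_of_le hR hg)).2
  have hmY : Y.countP (fun g => A.χ g ≠ 1) = S.countP (fun g => A.χ g ≠ 1) := by
    rw [hY, Multiset.countP_add, hRN, zero_add]
  rcases Nat.lt_or_ge (S.countP (fun g => A.χ g ≠ 1)) 2 with hm | hm
  · obtain hm | hm : S.countP (fun g => A.χ g ≠ 1) = 0 ∨ S.countP (fun g => A.χ g ≠ 1) = 1 := by
      omega
    · rw [Multiset.countP_eq_zero] at hm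
      have := hS.card_le_of_mem (MonoidHom.mker A.χ) fun g hg =>
        MonoidHom.mem_mker.2 (not_not.1 (hm g hg))
      have := A.card_translations_le
      omega
    · rw [Multiset.countP_eq_card_filter, Multiset.card_eq_one] at hm
      obtain ⟨b, hb⟩ := hm
      have hb' : b ∈ S.filter (fun g => A.χ g ≠ 1) := by
        rw [hb]
        simp
      replace hb' := (Multiset.mem_filter.1 hb').2
      have := (A.isProductOne_iff.1 hS.2.1).1
      rw [← hsplit, lin_add, hlinH, one_mul] at this
      change A.lin (S.filter (fun g => A.χ g ≠ 1)) = 1 at this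
      rw [hb, lin_singleton] at this
      exact hb' this
  · have hYc : S.card = R.card + Y.card := by rw [hY, Multiset.card_add]
    refine A.not_isMinimalProductOne hR0 hR1 (le_refl Y) ?_ (hY ▸ hS)
    exact A.le_card_trans_of_counts hp hp2 hq2
      (fun g hg => h1 g (by rw [hY]; exact Multiset.mem_add.2 (Or.inr hg)))
      (by omega) (by omega) (by omega)

/-- In a minimal product-one sequence of length at least `2 * q + 1`, every class has fewer than
`q + p - 1` terms. -/
lemma countP_cls_lt (hp : p.Prime) (hpq : p < q) {S : Multiset G}
    (hS : IsMinimalProductOne S) (hl : 2 * q + 1 ≤ S.card) (h1 : ∀ g ∈ S, g ≠ 1) (κ : ZMod q) :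
    S.countP (fun g => A.cls g = some κ) < q + p - 1 := by
  classical
  by_contra! hn
  have hp2 := hp.two_le
  have hcount : S.countP (fun g => A.cls g = some κ) ≤
      (S.countP (fun g => A.cls g ≠ some κ) + 1) * (p - 1) := by
    obtain ⟨l, rfl, hl1⟩ := hS.2.1
    have := List.countP_le_of_blocks (fun g => decide (A.cls g = some κ)) (p - 1) l (by
      intro l₁ l₂ l₃ hl' hl2
      by_contra! hlen
      have hfin : (A.fixing κ : Set G).Finite :=
        Set.finite_coe_iff.1 (inferInstanceAs (Finite (A.fixing κ)))
      obtain ⟨m₁, m₂, m₃, hm, hm2, hm3⟩ := exists_block_prod_eq_one (l₂.take p) hfin.toFinset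
        (fun i _ => by
          simp only [Set.Finite.mem_toFinset, SetLike.mem_coe]
          exact Submonoid.list_prod_mem _ fun g hg => (A.cls_eq_some_iff.1 (by
            simpa using hl2 g (List.mem_of_mem_take (List.mem_of_mem_take hg)))).2)
        (by
          rw [← Set.ncard_eq_toFinset_card _ hfin, ← Nat.card_coe_set_eq, List.length_take,
            Nat.min_eq_left (by omega)]
          exact A.card_fixing_le hp κ)
      have e : l = (l₁ ++ m₁) ++ m₂ ++ (m₃ ++ l₂.drop p ++ l₃) := by
        rw [hl']
        conv_lhs => rw [← List.take_append_drop p l₂, hm]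
        simp
      rw [e] at hS hl1
      refine hS.block_ne_one hl1 hm2 (fun h0 => ?_) hm3
      have h1 := congrArg List.length h0
      have h2 := congrArg List.length hm
      have h3 := congrArg List.length e
      simp only [List.length_append, List.length_take, List.length_drop, List.length_nil]
        at h1 h2 h3
      simp only [Multiset.coe_card] at hl
      omega)
    simpa using this
  have hcard := card_eq_countP_add_countP_ne A.cls (some κ) S
  have hsplit := Multiset.filter_add_not (fun g => A.cls g = some κ) S
  obtain ⟨R, hR, hR0, hR1, hRp⟩ := A.exists_short_of_class hp
    (T := S.filter (fun g => A.cls g = some κ)) (fun g hg => (Multiset.mem_filter.1 hg).2)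
    (by rw [← Multiset.countP_eq_card_filter]; omega)
  obtain ⟨K, hK⟩ := Multiset.le_iff_exists_add.1 hR
  have hKc := congrArg Multiset.card hK
  rw [← Multiset.countP_eq_card_filter, Multiset.card_add] at hKc
  obtain ⟨k, hk, hkc⟩ := Multiset.exists_le_card_eq (T := K) (n := q - 1) (by omega)
  have hfull := A.min_le_card_trans_class hp
    (bs := S.filter (fun g => A.cls g ≠ some κ)) (ks := k) (κ := κ)
    (fun g hg => ⟨h1 g (Multiset.mem_filter.1 hg).1, (Multiset.mem_filter.1 hg).2⟩)
    (fun g hg => (Multiset.mem_filter.1 (Multiset.mem_of_le (hk.trans (by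
      rw [hK]; exact Multiset.le_add_left _ _)) hg)).2)
    (by
      rw [← Multiset.countP_eq_card_filter, hkc]
      rw [add_mul, one_mul] at hcount
      omega)
  refine A.not_isMinimalProductOne (Y := S.filter (fun g => A.cls g ≠ some κ) + K) hR0 hR1
    (add_le_add le_rfl hk) (by omega) ?_
  rwa [add_left_comm, ← hK, add_comm, hsplit]

/-- In a minimal product-one sequence of length at least `2 * q + 1`, every class has fewer than
`p` terms. -/
lemma countP_cls_lt_of_le (hp : p.Prime) (hp2 : p ≠ 2) (hpq : 2 * p < q) {S : Multiset G}
    (hS : IsMinimalProductOne S) (hl : 2 * q + 1 ≤ S.card) (h1 : ∀ g ∈ S, g ≠ 1) (κ : ZMod q) :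
    S.countP (fun g => A.cls g = some κ) < p := by
  have := hp.two_le
  by_contra! hn
  obtain ⟨κ, -, hmax⟩ := Finset.univ.exists_max_image
    (fun κ => S.countP (fun g => A.cls g = some κ)) ⟨κ, Finset.mem_univ _⟩
  replace hn := hn.trans (hmax _ (Finset.mem_univ _))
  have hm := A.le_countP_χ_ne_one hp hp2 (by omega) hS hl h1
  have hlt := A.countP_cls_lt hp (by omega) hS hl h1 κ
  obtain ⟨R, hR, hR0, hR1, hRp⟩ := A.exists_short_of_class hp
    (T := S.filter (fun g => A.cls g = some κ)) (fun g hg => (Multiset.mem_filter.1 hg).2)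
    (by rwa [← Multiset.countP_eq_card_filter])
  have hRκ : ∀ g ∈ R, A.cls g = some κ := fun g hg =>
    (Multiset.mem_filter.1 (Multiset.mem_of_le hR hg)).2
  obtain ⟨Y, rfl⟩ := Multiset.le_iff_exists_add.1 (hR.trans (Multiset.filter_le _ _))
  have hY1 : ∀ g ∈ Y, g ≠ 1 := fun g hg => h1 g (Multiset.mem_add.2 (Or.inr hg))
  refine A.not_isMinimalProductOne hR0 hR1 (le_refl Y) ?_ hS
  have hRout : R.countP (fun g => A.cls g ≠ some κ) = 0 := Multiset.countP_eq_zero.2 fun g hg => by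
    simpa using hRκ g hg
  have hRH : R.countP (fun g => A.χ g = 1) = 0 := Multiset.countP_eq_zero.2 fun g hg =>
    (A.cls_eq_some_iff.1 (hRκ g hg)).1
  have hcard := card_eq_countP_add_countP_ne A.χ 1 Y
  have hRN := Multiset.countP_le_card (fun g => A.χ g ≠ 1) R
  rw [Multiset.countP_add] at hm
  rw [Multiset.card_add] at hl
  rcases Nat.lt_or_ge (Y.countP (fun g => A.χ g = 1)) (q - 1) with hh | hh
  · refine A.le_card_trans_of_counts hp hp2 (by omega) hY1 (by omega) (by omega) fun _ κ' => ?_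
    by_cases hκ : κ' = κ
    · subst hκ
      have := card_eq_countP_add_countP_ne A.cls (some κ') (R + Y)
      rw [Multiset.card_add, Multiset.countP_add (fun g => A.cls g ≠ some κ')] at this
      omega
    · have h3 := card_eq_countP_add_countP_ne A.cls (some κ') (R + Y)
      have h4 := hmax κ' (Finset.mem_univ _)
      have h5 := countP_eq_add_countP_ne_le A.cls (k := some κ) (k' := some κ')
        (by simpa using Ne.symm hκ) (R + Y)
      have h6 := Multiset.countP_le_card (fun g => A.cls g ≠ some κ') R
      rw [Multiset.card_add] at h3
      have h7 := Multiset.countP_add (fun g => A.cls g ≠ some κ') R Y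
      omega
  · obtain ⟨b, hb, hbχ⟩ : ∃ b ∈ Y, A.χ b ≠ 1 := by
      have : 0 < Y.countP (fun g => A.χ g ≠ 1) := by omega
      exact Multiset.countP_pos.1 this
    have h := A.min_le_card_trans_add_translations (T := {b})
      (hs := Y.filter (fun g => A.χ g = 1)) (by simpa using hbχ) fun g hg =>
        ⟨hY1 g (Multiset.mem_filter.1 hg).1, (Multiset.mem_filter.1 hg).2⟩
    rw [trans_singleton, Finset.card_singleton, ← Multiset.countP_eq_card_filter] at h
    refine le_trans (by omega) (h.trans (A.card_trans_mono (T := Y) ?_))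
    conv_rhs => rw [← Multiset.filter_add_not (fun g => A.χ g = 1) Y, add_comm]
    refine add_le_add ?_ le_rfl
    rw [Multiset.singleton_le, Multiset.mem_filter]
    exact ⟨hb, hbχ⟩

/-- In a minimal product-one sequence of length at least `2 * q + 1`, there are fewer than `q`
translations. -/
lemma countP_χ_eq_one_lt (hp : p.Prime) (hp2 : p ≠ 2) (hpq : 2 * p < q) {S : Multiset G}
    (hS : IsMinimalProductOne S) (hl : 2 * q + 1 ≤ S.card) (h1 : ∀ g ∈ S, g ≠ 1) :
    S.countP (fun g => A.χ g = 1) < q := by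
  have := hp.two_le
  by_contra! hn
  have hm := A.le_countP_χ_ne_one hp hp2 (by omega) hS hl h1
  obtain ⟨R, hR, hR0, hR1, hRq⟩ := A.exists_short_of_translations
    (T := S.filter (fun g => A.χ g = 1)) (fun g hg => (Multiset.mem_filter.1 hg).2)
    (by rwa [← Multiset.countP_eq_card_filter])
  obtain ⟨Y, rfl⟩ := Multiset.le_iff_exists_add.1 (hR.trans (Multiset.filter_le _ _))
  have hRN : R.countP (fun g => A.χ g ≠ 1) = 0 := Multiset.countP_eq_zero.2 fun g hg => by
    simpa using (Multiset.mem_filter.1 (Multiset.mem_of_le hR hg)).2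
  rw [Multiset.countP_add] at hm
  have hl' := hl
  rw [Multiset.card_add] at hl'
  refine A.not_isMinimalProductOne hR0 hR1 (le_refl Y) ?_ hS
  refine A.le_card_trans_of_counts hp hp2 (by omega)
    (fun g hg => h1 g (Multiset.mem_add.2 (Or.inr hg))) (by omega) (by omega) fun _ κ => ?_
  have := A.countP_cls_lt_of_le hp hp2 hpq hS hl h1 κ
  rw [Multiset.countP_add] at this
  have := card_eq_countP_add_countP_ne A.cls (some κ) Y
  omega

/-- A subsequence of length `q + 1` of a sequence without popular classes has all products. -/
lemma le_card_trans_of_le (hp : p.Prime) (hp2 : p ≠ 2) (hpq : 2 * p < q) {S T : Multiset G}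
    (hT : T ≤ S) (hTc : q + 1 ≤ T.card) (h1 : ∀ g ∈ S, g ≠ 1)
    (hK : ∀ κ, S.countP (fun g => A.cls g = some κ) < p)
    (hH : S.countP (fun g => A.χ g = 1) < q) : q ≤ (A.trans T).card := by
  have := hp.two_le
  have h2 := Multiset.countP_le_of_le (fun g => A.χ g = 1) hT
  have h3 := card_eq_countP_add_countP_ne A.χ 1 T
  refine A.le_card_trans_of_counts hp hp2 (by omega) (fun g hg => h1 g (Multiset.mem_of_le hT hg))
    hTc (by omega) fun _ κ => ?_
  have h4 := Multiset.countP_le_of_le (fun g => A.cls g = some κ) hT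
  have h5 := card_eq_countP_add_countP_ne A.cls (some κ) T
  have h6 := hK κ
  omega

open Classical in
/-- The linear parts obtained by choosing one entry from each pair in a list. -/
noncomputable def choices (ps : List (G × G)) : Finset (ZMod q) :=
  {c | ∃ T ≤ ofPairs ps, T.card = ps.length ∧ A.lin T = c}

lemma mem_choices {ps : List (G × G)} {c : ZMod q} :
    c ∈ A.choices ps ↔ ∃ T ≤ ofPairs ps, T.card = ps.length ∧ A.lin T = c := by
  simp [choices]

lemma min_le_card_choices (hp : p.Prime) {ps : List (G × G)}
    (hps : ∀ r ∈ ps, A.χ r.1 ≠ A.χ r.2) : min p (ps.length + 1) ≤ (A.choices ps).card := by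
  induction ps with
  | nil =>
    refine (min_le_right _ _).trans (Finset.card_pos.2 ⟨1, A.mem_choices.2 ⟨0, ?_⟩⟩)
    simp
  | cons r ps ih =>
    have hr := hps r (by simp)
    have ih := ih fun s hs => hps s (by simp [hs])
    have e : ofPairs (r :: ps) = {r.1} + {r.2} + ofPairs ps := by simp [ofPairs]
    have hmem : ∀ g : G, ({g} : Multiset G) ≤ {r.1} + {r.2} → ∀ c ∈ A.choices ps,
        A.χ g * c ∈ A.choices (r :: ps) := by
      intro g hg c hc
      obtain ⟨T, hT, hTc, rfl⟩ := A.mem_choices.1 hc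
      refine A.mem_choices.2 ⟨{g} + T, ?_, ?_, by rw [lin_add, lin_singleton]⟩
      · rw [e]
        exact add_le_add hg hT
      · simp [hTc, add_comm]
    have hmem1 := hmem r.1 (Multiset.le_add_right _ _)
    have hmem2 := hmem r.2 (Multiset.le_add_left _ _)
    have hinj : Set.InjOn (fun c : ZMod q => A.χ r.1 * c) (A.choices ps) := fun a _ b _ hab =>
      mul_left_cancel₀ (A.χ_ne_zero _) hab
    have hle := Finset.card_le_card_of_injOn _ hmem1 hinj
    have hlt : (A.choices ps).card < p → (A.choices ps).card < (A.choices (r :: ps)).card := by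
      intro hlt
      by_contra! hge
      have himage : (A.choices ps).image (fun c => A.χ r.1 * c) = A.choices (r :: ps) := by
        refine Finset.eq_of_subset_of_card_le (Finset.image_subset_iff.2 hmem1) ?_
        rwa [Finset.card_image_of_injOn hinj]
      obtain ⟨y, hy⟩ := Finset.card_pos.1 (lt_of_lt_of_le
        (Nat.lt_min.2 ⟨hp.pos, Nat.succ_pos _⟩) ih)
      have hy0 : y ≠ 0 := by
        obtain ⟨T, -, -, rfl⟩ := A.mem_choices.1 hy
        exact A.lin_ne_zero T
      have h1 := A.χ_ne_zero r.1
      have hβ : (A.χ r.1)⁻¹ * A.χ r.2 ≠ 1 := fun h => hr (by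
        rw [inv_mul_eq_one₀ h1] at h
        exact h)
      have := le_card_of_rotation hp (Y := A.choices ps) (β := (A.χ r.1)⁻¹ * A.χ r.2) (v := 0)
        (y := y) hβ
        (by rw [mul_pow, inv_pow, A.χ_pow, A.χ_pow, inv_one, one_mul]) (fun c hc => by
          have h := hmem2 c hc
          rw [← himage, Finset.mem_image] at h
          obtain ⟨d, hd, heq⟩ := h
          convert hd using 1
          rw [add_zero, mul_assoc, ← heq, inv_mul_cancel_left₀ h1]) hy (fun h => hβ
            (mul_right_cancel₀ hy0 (by rw [one_mul, ← add_zero (_ * y), h])))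
      omega
    rw [List.length_cons]
    omega

end AffineCoords

lemma exists_distinct_triple {G κ : Type*} [DecidableEq κ] (f : G → κ) {W : Multiset G} {n : ℕ}
    (hW : 2 * n < W.card) (h : ∀ k, W.countP (fun g => f g = k) ≤ n) :
    ∃ a : Fin 3 → G, (∀ i, a i ∈ W) ∧ Function.Injective (fun i => f (a i)) := by
  have key : ∀ k k', ∃ g ∈ W, f g ≠ k ∧ f g ≠ k' := by
    intro k k'
    by_contra! hall
    have h1 := card_eq_countP_add_countP_ne f k W
    have h2 : W.countP (fun g => f g ≠ k) ≤ W.countP (fun g => f g = k') := by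
      rw [Multiset.countP_eq_card_filter, Multiset.countP_eq_card_filter]
      refine Multiset.card_le_card (Multiset.le_filter.2 ⟨Multiset.filter_le _ _, fun g hg => ?_⟩)
      exact hall g (Multiset.mem_filter.1 hg).1 (Multiset.mem_filter.1 hg).2
    have h3 := h k
    have h4 := h k'
    omega
  obtain ⟨a, ha⟩ := Multiset.card_pos_iff_exists_mem.1 (by omega : 0 < W.card)
  obtain ⟨b, hb, hba, -⟩ := key (f a) (f a)
  obtain ⟨c, hc, hca, hcb⟩ := key (f a) (f b)
  refine ⟨![a, b, c], fun i => ?_, fun i j hij => ?_⟩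
  · fin_cases i <;> assumption
  · fin_cases i <;> fin_cases j <;> simp_all

namespace AffineCoords

lemma card_ofPairs {G : Type*} (ps : List (G × G)) : (ofPairs ps).card = 2 * ps.length := by
  induction ps with
  | nil => simp [ofPairs]
  | cons r ps ih =>
    have e : ofPairs (r :: ps) = {r.1} + {r.2} + ofPairs ps := by simp [ofPairs]
    rw [e, Multiset.card_add, ih, List.length_cons]
    simp only [Multiset.card_add, Multiset.card_singleton]
    ring

variable {G : Type*} [Group G] {p q : ℕ} [Fact q.Prime] (A : AffineCoords G p q)

/-- In a minimal product-one sequence of length at least `2 * q + 1`, product-one subsequences are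
long. -/
lemma card_le_of_isProductOne (A : AffineCoords G p q) (hp : p.Prime) (hp2 : p ≠ 2)
    (hpq : 2 * p < q) {S R : Multiset G} (hS : IsMinimalProductOne S) (hl : 2 * q + 1 ≤ S.card)
    (hR : R ≤ S) (hR0 : R ≠ 0) (hR1 : IsProductOne R) : S.card ≤ R.card + q := by
  by_contra! h
  have h1 := hS.ne_one (by omega)
  have hK := A.countP_cls_lt_of_le hp hp2 hpq hS hl h1
  have hH := A.countP_χ_eq_one_lt hp hp2 hpq hS hl h1
  obtain ⟨Y, rfl⟩ := Multiset.le_iff_exists_add.1 hR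
  rw [Multiset.card_add] at h
  exact A.not_isMinimalProductOne hR0 hR1 le_rfl
    (A.le_card_trans_of_le hp hp2 hpq (Multiset.le_add_left _ _) (by omega) h1 hK hH) hS

lemma mem_choices_of_pow_eq_one (hp : p.Prime) {ps : List (G × G)}
    (hps : ∀ r ∈ ps, A.χ r.1 ≠ A.χ r.2) (hl : p ≤ ps.length + 1) {c : ZMod q} (hc : c ^ p = 1) :
    c ∈ A.choices ps := by
  by_contra hcm
  have h1 := A.min_le_card_choices hp hps
  have h2 := card_roots_le hp (insert c (A.choices ps)) fun y hy => by
    rcases Finset.mem_insert.1 hy with rfl | hy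
    · exact hc
    · obtain ⟨T, -, -, rfl⟩ := A.mem_choices.1 hy
      exact A.lin_pow T
  rw [Finset.card_insert_of_notMem hcm] at h2
  omega

lemma lin_inv_pow (T : Multiset G) : (A.lin T)⁻¹ ^ p = 1 := by
  rw [inv_pow, A.lin_pow, inv_one]

/-- In a minimal product-one sequence of length at least `2 * q + 1`, one linear part dominates. -/
lemma exists_countP_χ_ne_lt (hp : p.Prime) (hp2 : p ≠ 2) (hpq : 2 * p < q) {S : Multiset G}
    (hS : IsMinimalProductOne S) (hl : 2 * q + 1 ≤ S.card) :
    ∃ c, S.countP (fun g => A.χ g ≠ c) < p - 1 := by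
  by_contra! h
  have hp2' := hp.two_le
  obtain ⟨ps, hpl, hpS, hps⟩ := exists_pairs A.χ (p - 1) S (by omega) h
  obtain ⟨U, hU⟩ := Multiset.le_iff_exists_add.1 hpS
  have hUc := congrArg Multiset.card hU
  rw [Multiset.card_add, card_ofPairs, hpl] at hUc
  obtain ⟨Z, hZ, hZc⟩ := Multiset.exists_le_card_eq (T := U) (n := q + 1 - (p - 1)) (by omega)
  obtain ⟨T, hT, hTc, hTl⟩ := A.mem_choices.1
    (A.mem_choices_of_pow_eq_one hp hps (by omega) (A.lin_inv_pow Z))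
  have hTZ : T + Z ≤ S := hU ▸ add_le_add hT hZ
  have hlin : A.lin (T + Z) = 1 := by
    rw [lin_add, hTl, inv_mul_cancel₀ (A.lin_ne_zero Z)]
  obtain ⟨R, hR⟩ := Multiset.le_iff_exists_add.1 hTZ
  have hRc := congrArg Multiset.card hR
  rw [Multiset.card_add, Multiset.card_add, hTc, hpl, hZc] at hRc
  have hRl : A.lin R = 1 := by
    have := (A.isProductOne_iff.1 hS.2.1).1
    rwa [hR, lin_add, hlin, one_mul] at this
  obtain ⟨R', hR', hR0, hR1⟩ := A.exists_isProductOne_of_lin_eq_one hRl (by omega)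
  have h1 := A.card_le_of_isProductOne hp hp2 hpq hS hl
    (hR'.trans (hR ▸ Multiset.le_add_left _ _)) hR0 hR1
  have h2 := Multiset.card_le_card hR'
  omega

lemma inv_mul_mem_trans {V : Multiset G} {c : ZMod q} (hV0 : V ≠ 0) (hVc : ∀ g ∈ V, A.χ g = c)
    (hV : A.lin V = 1) {y : ZMod q} (hy : y ∈ A.trans V) : c⁻¹ * y ∈ A.trans V := by
  obtain ⟨l, rfl, rfl⟩ := A.mem_trans.1 hy
  cases l with
  | nil => exact absurd rfl hV0
  | cons h t =>
    have := A.rotate_mem_trans (l := [h]) (l' := t) hV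
    rwa [List.prod_singleton, hVc h (by simp)] at this

/-- Among many elements with a common linear part there are `p` with a product equal to one or with
more than `p` different products. -/
lemma exists_le_card_trans (hp : p.Prime) (hp2 : p ≠ 2) (hpq : 2 * p < q) {W : Multiset G}
    {c : ZMod q} (hc1 : c ≠ 1) (hWc : ∀ g ∈ W, A.χ g = c) (hW1 : ∀ g ∈ W, g ≠ 1)
    (hcls : ∀ k, W.countP (fun g => A.cls g = k) < p) (hW : 3 * p ≤ W.card) :
    ∃ V ≤ W, V.card = p ∧ (0 ∈ A.trans V ∨ p + 1 ≤ (A.trans V).card) := by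
  have hp2' := hp.two_le
  obtain ⟨t, ht⟩ := hp.odd_of_ne_two hp2
  obtain ⟨ps, hpl, hpW, hps⟩ := exists_pairs A.cls t W (by omega) fun k => by
    have h1 := card_eq_countP_add_countP_ne A.cls k W
    have h2 := hcls k
    omega
  obtain ⟨U, rfl⟩ := Multiset.le_iff_exists_add.1 hpW
  have hYc := card_ofPairs ps
  rw [hpl] at hYc
  rw [Multiset.card_add] at hW
  obtain ⟨a, haU, ha⟩ := exists_distinct_triple A.cls (W := U) (n := p - 1) (by omega) fun k => by
    have h1 := hcls k
    have h2 := Multiset.countP_le_of_le (fun g => A.cls g = k)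
      (Multiset.le_add_left U (ofPairs ps))
    omega
  have hgood : A.Good ps := fun r hr => by
    have hmem : ∀ g, g = r.1 ∨ g = r.2 → g ∈ ofPairs ps := by
      intro g hg
      obtain ⟨l₁, l₂, rfl⟩ := List.append_of_mem hr
      rcases hg with rfl | rfl <;> simp [ofPairs]
    exact ⟨hW1 _ (Multiset.mem_add.2 (Or.inl (hmem _ (Or.inl rfl)))),
      hW1 _ (Multiset.mem_add.2 (Or.inl (hmem _ (Or.inr rfl)))), hps r hr⟩
  have hX := A.min_le_card_trans_pairs hp hp2 (by omega) hgood
  rw [hpl] at hX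
  have hle : ∀ i, ofPairs ps + {a i} ≤ ofPairs ps + U := fun i =>
    add_le_add le_rfl (Multiset.singleton_le.2 (haU i))
  have hcard : ∀ i, (ofPairs ps + {a i}).card = p := fun i => by
    rw [Multiset.card_add, hYc, Multiset.card_singleton, ht]
  have hVc : ∀ i, ∀ g ∈ ofPairs ps + {a i}, A.χ g = c := fun i g hg =>
    hWc g (Multiset.mem_of_le (hle i) hg)
  have hac : ∀ i, A.χ (a i) = c := fun i => hWc _ (Multiset.mem_add.2 (Or.inr (haU i)))
  have hc0 : c ≠ 0 := hac 0 ▸ A.χ_ne_zero (a 0)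
  have hcp : c ^ p = 1 := by rw [← hac 0, A.χ_pow]
  by_contra! hcon
  refine not_translates_in_rotation_invariant hp (by omega) (X := A.trans (ofPairs ps))
    (β := c⁻¹) (s := fun i => A.lin (ofPairs ps) * A.x (a i))
    (O := fun i => A.trans (ofPairs ps + {a i})) (by omega) (inv_ne_zero hc0)
    (inv_eq_one.not.2 hc1) ?_ (by rw [inv_pow, hcp, inv_one]) ?_
    (fun i => (hcon _ (hle i) (hcard i)).1) ?_
    (fun i => Nat.lt_succ_iff.1 (hcon _ (hle i) (hcard i)).2) ?_
  · exact sq_ne_one_of_pow_eq_one hp hp2 (by rw [inv_pow, hcp, inv_one]) (inv_eq_one.not.2 hc1)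
  · intro i j hij
    refine ha (congrArg A.cls (A.ext _ _ (by rw [hac, hac]) ?_))
    exact mul_left_cancel₀ (A.lin_ne_zero _) hij
  · intro i y hy
    refine A.inv_mul_mem_trans (fun h => ?_) (hVc i) ?_ hy
    · have := hcard i
      rw [h, Multiset.card_zero] at this
      omega
    · rw [A.lin_eq_pow (hVc i), hcard, hcp]
  · intro i y hy
    exact A.add_mem_trans hy (by simp)

/-- A minimal product-one sequence has at most `2 * q` terms. -/
theorem card_le_two_mul (A : AffineCoords G p q) (hp : p.Prime) (hp2 : p ≠ 2) (hpq : 2 * p < q)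
    (hpd : p ∣ q - 1) {S : Multiset G} (hS : IsMinimalProductOne S) : S.card ≤ 2 * q := by
  by_contra! hl
  replace hl : 2 * q + 1 ≤ S.card := hl
  have hp2' := hp.two_le
  have h1 := hS.ne_one (by omega)
  have hK := A.countP_cls_lt_of_le hp hp2 hpq hS hl h1
  have hshort := fun R => A.card_le_of_isProductOne (R := R) hp hp2 hpq hS hl
  obtain ⟨c, hc⟩ := A.exists_countP_χ_ne_lt hp hp2 hpq hS hl
  have hc1 : c ≠ 1 := by
    rintro rfl
    have := A.le_countP_χ_ne_one hp hp2 (by omega) hS hl h1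
    omega
  have hWS := Multiset.filter_le (fun g => A.χ g = c) S
  have hWcard := card_eq_countP_add_countP_ne A.χ c S
  rw [Multiset.countP_eq_card_filter] at hWcard
  have hWc : ∀ g ∈ S.filter (fun g => A.χ g = c), A.χ g = c := fun g hg =>
    (Multiset.mem_filter.1 hg).2
  set W := S.filter (fun g => A.χ g = c)
  obtain ⟨V, hV, hVcard, hVt⟩ := A.exists_le_card_trans hp hp2 hpq hc1 hWc
    (fun g hg => h1 g (Multiset.mem_of_le hWS hg)) (fun k => by
      cases k with
      | none =>
        rw [Multiset.countP_eq_zero.2 fun g hg => ?_]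
        · exact hp.pos
        · rw [cls_eq_none_iff, hWc g hg]
          exact hc1
      | some κ => exact (Multiset.countP_le_of_le _ hWS).trans_lt (hK κ)) (by omega)
  have hcp : c ^ p = 1 := by
    obtain ⟨g, hg⟩ := Multiset.card_pos_iff_exists_mem.1 (by omega : 0 < W.card)
    rw [← hWc g hg, A.χ_pow]
  have hV0 : V ≠ 0 := by
    rintro rfl
    rw [Multiset.card_zero] at hVcard
    omega
  have hVl : A.lin V = 1 := by
    rw [A.lin_eq_pow (fun g hg => hWc g (Multiset.mem_of_le hV hg)), hVcard, hcp]
  rcases hVt with hVt | hVt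
  · have := hshort V (hV.trans hWS) hV0 (A.isProductOne_iff.2 ⟨hVl, hVt⟩)
    omega
  obtain ⟨U, hU⟩ := Multiset.le_iff_exists_add.1 hV
  have hUc := congrArg Multiset.card hU
  rw [Multiset.card_add] at hUc
  obtain ⟨R, hR, hRc⟩ := Multiset.exists_le_card_eq (T := U) (n := q - 1 - p) (by omega)
  have hVR : V + R ≤ S := (hU ▸ add_le_add le_rfl hR : V + R ≤ W).trans hWS
  have hRl : A.lin R = 1 := by
    obtain ⟨m, hm⟩ : p ∣ q - 1 - p := Nat.dvd_sub hpd dvd_rfl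
    rw [A.lin_eq_pow (c := c) (fun g hg => hWc g ?_), hRc, hm, pow_mul, hcp, one_pow]
    rw [hU]
    exact Multiset.mem_add.2 (Or.inr (Multiset.mem_of_le hR hg))
  by_cases hfree : ∀ T ≤ R, T ≠ 0 → ¬ IsProductOne T
  · have h2 := A.card_lt_card_subTrans hRl hfree
    obtain ⟨y, hy⟩ : (A.trans V ∩ (A.subTrans R).image (fun y => -y)).Nonempty := by
      by_contra hne
      rw [Finset.not_nonempty_iff_eq_empty, ← Finset.disjoint_iff_inter_eq_empty] at hne
      have h3 := Finset.card_le_univ (A.trans V ∪ (A.subTrans R).image (fun y => -y))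
      rw [Finset.card_union_of_disjoint hne, Finset.card_image_of_injective _ neg_injective,
        ZMod.card] at h3
      omega
    obtain ⟨hyV, hyR⟩ := Finset.mem_inter.1 hy
    obtain ⟨z, hz, rfl⟩ := Finset.mem_image.1 hyR
    obtain ⟨T, hT, hTl, hzT⟩ := A.mem_subTrans.1 hz
    have h4 := hshort (V + T) ((add_le_add le_rfl hT).trans hVR) (by simp [hV0])
      (A.isProductOne_iff.2 ⟨by rw [lin_add, hVl, hTl, one_mul], by
        simpa [hVl] using A.add_mem_trans hyV hzT⟩)
    have h5 := Multiset.card_le_card hT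
    rw [Multiset.card_add] at h4
    omega
  · push Not at hfree
    obtain ⟨T, hT, hT0, hT1⟩ := hfree
    have h4 := hshort T (hT.trans ((Multiset.le_add_left _ _).trans hVR)) hT0 hT1
    have h5 := Multiset.card_le_card hT
    omega

end AffineCoords

namespace AffineCoords

variable {G : Type*} [Group G] {p q : ℕ} [Fact q.Prime]

/-- Coordinates on an extension of a cyclic group of prime order by a cyclic group of prime order,
acting nontrivially. -/
theorem nonempty_of_normal (hp : p.Prime) (H : Subgroup G) [hHn : H.Normal] (hH : Nat.card H = q)
    (hHi : H.index = p) (hna : ¬ ∀ a b : G, a * b = b * a) : Nonempty (AffineCoords G p q) := by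
  have : Fact p.Prime := ⟨hp⟩
  have hcyc : IsCyclic (G ⧸ H) := isCyclic_of_prime_card (p := p) hHi
  have hcard : Nat.card (Multiplicative (ZMod q)) = q := by simp
  let E : H ≃* Multiplicative (ZMod q) := mulEquivOfPrimeCardEq hH hcard
  let e : H → ZMod q := fun h => (E h).toAdd
  have e_mul : ∀ h k, e (h * k) = e h + e k := fun h k => by simp [e]
  have e_inv : ∀ h, e h⁻¹ = - e h := fun h => by simp [e]
  have e_symm : ∀ y, e (E.symm (Multiplicative.ofAdd y)) = y := fun y => by simp [e]
  have e_inj : Function.Injective e := E.injective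
  have e_one : e 1 = 0 := by simp [e]
  have e_conj : ∀ g h, e (MulAut.conjNormal g h) =
      e (MulAut.conjNormal g (E.symm (Multiplicative.ofAdd 1))) * e h := by
    intro g h
    let f : ZMod q →+ ZMod q :=
      { toFun := fun y => e (MulAut.conjNormal g (E.symm (Multiplicative.ofAdd y)))
        map_zero' := by simp [e]
        map_add' := fun y z => by simp [e] }
    have h1 := ZMod.map_smul f (e h) 1
    have h2 : E.symm (Multiplicative.ofAdd (e h)) = h := by simp [e]
    simpa [f, h2, mul_comm] using h1
  let χ : G →* ZMod q :=
    { toFun := fun g => e (MulAut.conjNormal g (E.symm (Multiplicative.ofAdd 1)))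
      map_one' := by simp [e]
      map_mul' := fun g h => by rw [map_mul, MulAut.mul_apply, e_conj g] }
  replace e_conj : ∀ g h, e (MulAut.conjNormal g h) = χ g * e h := e_conj
  have hcomm : ∀ h k : H, h * k = k * h := fun h k => e_inj (by rw [e_mul, e_mul, add_comm])
  have χ_H : ∀ h ∈ H, χ h = 1 := by
    intro h hh
    have h1 := e_conj h (E.symm (Multiplicative.ofAdd 1))
    have h2 : MulAut.conjNormal h (E.symm (Multiplicative.ofAdd 1)) =
        E.symm (Multiplicative.ofAdd (1 : ZMod q)) := by
      have := hcomm ⟨h, hh⟩ (E.symm (Multiplicative.ofAdd (1 : ZMod q)))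
      ext
      rw [MulAut.conjNormal_apply, mul_inv_eq_iff_eq_mul]
      exact congrArg Subtype.val this
    rw [h2, e_symm, mul_one] at h1
    exact h1.symm
  have χ_ne_zero : ∀ g, χ g ≠ 0 := fun g h => by
    have := map_mul χ g g⁻¹
    rw [mul_inv_cancel, map_one, h, zero_mul] at this
    exact one_ne_zero this
  have exists_χ : ∃ t, χ t ≠ 1 := by
    by_contra! h
    have hle : (QuotientGroup.mk' H).ker ≤ Subgroup.center G := ?_
    · have := (QuotientGroup.mk' H).isMulCommutative_of_isCyclic_of_ker_le_center hle
      exact hna mul_comm'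
    rw [QuotientGroup.ker_mk']
    intro k hk
    rw [Subgroup.mem_center_iff]
    intro g
    have h1 := e_conj g ⟨k, hk⟩
    rw [h, one_mul] at h1
    have h2 := congrArg Subtype.val (e_inj h1)
    rwa [MulAut.conjNormal_apply, mul_inv_eq_iff_eq_mul] at h2
  obtain ⟨t, ht⟩ := exists_χ
  have hker : χ.ker ≤ H := by
    have hle : H ≤ χ.ker := fun h hh => MonoidHom.mem_ker.2 (χ_H h hh)
    have h1 := Subgroup.relIndex_mul_index hle
    rw [hHi] at h1
    rcases hp.eq_one_or_self_of_dvd _ (Dvd.intro _ h1) with h2 | h2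
    · exact Subgroup.relIndex_eq_one.1 h2
    · rw [h2] at h1
      have h3 : χ.ker = ⊤ := Subgroup.index_eq_one.1 (Nat.eq_of_mul_eq_mul_left hp.pos (by omega))
      exact absurd (MonoidHom.mem_ker.1 (h3 ▸ Subgroup.mem_top t)) ht
  have hmem : ∀ g, g * t * g⁻¹ * t⁻¹ ∈ H := by
    intro g
    rw [← QuotientGroup.eq_one_iff]
    have := mul_comm' (g : G ⧸ H) t
    simp only [QuotientGroup.mk_mul, QuotientGroup.mk_inv]
    rw [this]
    group
  let x : G → ZMod q := fun g => e ⟨g * t * g⁻¹ * t⁻¹, hmem g⟩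
  have x_mul : ∀ g h, x (g * h) = x g + χ g * x h := by
    intro g h
    simp only [x]
    rw [← e_conj, add_comm, ← e_mul]
    congr 1
    ext
    simp only [Subgroup.coe_mul, MulAut.conjNormal_apply]
    group
  have x_H : ∀ h : H, x h = (1 - χ t) * e h := by
    intro h
    rw [sub_mul, one_mul, ← e_conj, sub_eq_add_neg, ← e_inv, ← e_mul]
    simp only [x]
    congr 1
    ext
    simp only [Subgroup.coe_mul, Subgroup.coe_inv, MulAut.conjNormal_apply]
    group
  have ht' : 1 - χ t ≠ 0 := sub_ne_zero.2 (Ne.symm ht)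
  refine ⟨⟨χ, x, x_mul, ?_, ?_, ⟨t, ht⟩, ?_⟩⟩
  · intro g h h1 h2
    have hk : g⁻¹ * h ∈ H := hker (MonoidHom.mem_ker.2 (mul_left_cancel₀ (χ_ne_zero g) (by
      rw [← map_mul, mul_inv_cancel_left, mul_one, h1])))
    have h3 := x_mul g (g⁻¹ * h)
    rw [mul_inv_cancel_left, ← h2, left_eq_add, x_H ⟨_, hk⟩] at h3
    have h4 : e ⟨_, hk⟩ = 0 := by simpa [χ_ne_zero, ht'] using h3
    have h5 := congrArg Subtype.val (e_inj (h4.trans e_one.symm))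
    exact inv_mul_eq_one.1 h5
  · intro g
    rw [← map_pow, ← hHi]
    exact χ_H _ (Subgroup.pow_index_mem H g)
  · refine ⟨E.symm (Multiplicative.ofAdd (1 - χ t)⁻¹), χ_H _ (Subtype.property _), ?_⟩
    rw [x_H, e_symm, mul_inv_cancel₀ ht']

theorem nonempty_of_card [Finite G] (hp : p.Prime) (hpq : p < q) (hG : Nat.card G = p * q)
    (hna : ¬ ∀ a b : G, a * b = b * a) : Nonempty (AffineCoords G p q) := by
  have hq : q.Prime := Fact.out
  obtain ⟨H, hH⟩ := Sylow.exists_subgroup_card_pow_prime (G := G) q (n := 1) (by simp [hG])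
  rw [pow_one] at hH
  have hHi : H.index = p := by
    have := H.card_mul_index
    rw [hH, hG, mul_comm p] at this
    exact Nat.eq_of_mul_eq_mul_left hq.pos this
  have hmin : H.index = (Nat.card G).minFac := by
    rw [hHi, hG]
    refine le_antisymm ?_ (Nat.minFac_le_of_dvd hp.two_le (Dvd.intro _ rfl))
    have h1 := Nat.minFac_dvd (p * q)
    have h2 : (p * q).minFac.Prime := Nat.minFac_prime (mt Nat.eq_one_of_mul_eq_one_right hp.ne_one)
    rcases h2.dvd_mul.1 h1 with h | h
    · exact ((Nat.prime_dvd_prime_iff_eq h2 hp).1 h).ge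
    · exact hpq.le.trans ((Nat.prime_dvd_prime_iff_eq h2 hq).1 h).ge
  have := Subgroup.normal_of_index_eq_minFac_card hmin
  exact nonempty_of_normal hp H hH hHi hna

end AffineCoords

lemma Multiset.eq_replicate_of_add_eq {α : Type*} {U T : Multiset α} {n : ℕ} {a : α}
    (h : replicate n a = U + T) : ∃ i j, i + j = n ∧ U = replicate i a ∧ T = replicate j a := by
  have h1 := congrArg Multiset.card h
  rw [Multiset.card_replicate, Multiset.card_add] at h1
  refine ⟨_, _, h1.symm, Multiset.eq_replicate_card.2 fun b hb => ?_,
    Multiset.eq_replicate_card.2 fun b hb => ?_⟩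
  · exact Multiset.eq_of_mem_replicate (h ▸ Multiset.mem_add.2 (Or.inl hb))
  · exact Multiset.eq_of_mem_replicate (h ▸ Multiset.mem_add.2 (Or.inr hb))

namespace AffineCoords

variable {G : Type*} [Group G] {p q : ℕ} [Fact q.Prime] (A : AffineCoords G p q)

lemma χ_translation_pow {α : G} (hα : A.χ α = 1) (n : ℕ) : A.χ (α ^ n) = 1 := by
  rw [map_pow, hα, one_pow]

lemma x_translation_pow {α : G} (hα : A.χ α = 1) (hx : A.x α = 1) (n : ℕ) :
    A.x (α ^ n) = n := by
  induction n with
  | zero => simp [A.x_one]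
  | succ n ih => rw [pow_succ, A.x_mul, ih, A.χ_translation_pow hα, one_mul, hx, Nat.cast_succ]

lemma translation_pow_eq_one_iff {α : G} (hα : A.χ α = 1) (hx : A.x α = 1) (n : ℕ) :
    α ^ n = 1 ↔ q ∣ n := by
  rw [A.eq_one_iff, A.χ_translation_pow hα, A.x_translation_pow hα hx,
    ZMod.natCast_eq_zero_iff]
  simp

lemma x_mul_translation_pow {α τ : G} (hα : A.χ α = 1) (hx : A.x α = 1) (i j : ℕ) :
    A.x (τ * α ^ i * τ⁻¹ * α ^ j) = A.χ τ * i + j := by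
  have h := A.x_mul τ τ⁻¹
  rw [mul_inv_cancel, A.x_one] at h
  have h2 : A.χ τ * A.χ τ⁻¹ = 1 := by rw [← map_mul, mul_inv_cancel, map_one]
  simp only [A.x_mul, A.x_translation_pow hα hx, map_mul, A.χ_translation_pow hα, mul_one, h2]
  linear_combination -h

lemma not_isProductOne_pair_add_replicate {α τ : G} (hα : A.χ α = 1) (hx : A.x α = 1)
    (hτ : A.χ τ ≠ 1) :
    ¬ IsProductOne (τ ::ₘ (α * τ⁻¹ * α) ::ₘ Multiset.replicate (q - 2) α) := by
  have hq := (Fact.out : q.Prime).two_le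
  rintro ⟨l, hl, h1⟩
  obtain ⟨l₁, l₂, rfl⟩ := List.append_of_mem (a := τ) (l := l) (by
    rw [← Multiset.mem_coe, hl]
    simp)
  have e : ((l₁ ++ τ :: l₂ : List G) : Multiset G) = τ ::ₘ (l₂ ++ l₁ : List G) := by
    rw [Multiset.cons_coe, Multiset.coe_eq_coe]
    exact List.perm_append_comm
  rw [e, Multiset.cons_inj_right] at hl
  replace h1 : τ * (l₂ ++ l₁).prod = 1 := by
    rw [List.prod_append, List.prod_cons] at h1
    rw [List.prod_append, ← mul_assoc]
    exact mul_eq_one_comm.1 h1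
  generalize l₂ ++ l₁ = l at hl h1
  obtain ⟨m₁, m₂, rfl⟩ := List.append_of_mem (a := α * τ⁻¹ * α) (l := l) (by
    rw [← Multiset.mem_coe, hl]
    simp)
  have e : ((m₁ ++ (α * τ⁻¹ * α) :: m₂ : List G) : Multiset G) =
      (α * τ⁻¹ * α) ::ₘ ((m₁ : Multiset G) + (m₂ : Multiset G)) := by
    rw [Multiset.coe_add, Multiset.cons_coe, Multiset.coe_eq_coe]
    exact List.perm_middle
  rw [e, Multiset.cons_inj_right] at hl
  obtain ⟨i, j, hij, hi, hj⟩ := Multiset.eq_replicate_of_add_eq hl.symm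
  rw [← Multiset.coe_replicate, Multiset.coe_eq_coe, List.perm_replicate] at hi hj
  subst hi hj
  have h2 : τ * α ^ (i + 1) * τ⁻¹ * α ^ (j + 1) = 1 := by
    rw [← h1, List.prod_append, List.prod_cons, List.prod_replicate, List.prod_replicate, pow_succ,
      pow_succ']
    simp only [mul_assoc]
  have h3 := A.x_mul_translation_pow (τ := τ) hα hx (i + 1) (j + 1)
  rw [h2, A.x_one] at h3
  have h4 : ((i + 1 + (j + 1) : ℕ) : ZMod q) = 0 := by
    rw [ZMod.natCast_eq_zero_iff]
    exact dvd_of_eq (by omega)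
  have h5 : (1 - A.χ τ) * ((j + 1 : ℕ) : ZMod q) = 0 := by
    push_cast at *
    linear_combination -h3 - A.χ τ * h4
  rcases mul_eq_zero.1 h5 with h | h
  · exact hτ (sub_eq_zero.1 h).symm
  · rw [ZMod.natCast_eq_zero_iff] at h
    have := Nat.le_of_dvd (by omega) h
    omega

/-- There is a minimal product-one sequence of length `2 * q`. -/
theorem exists_isMinimalProductOne (A : AffineCoords G p q) :
    ∃ S : Multiset G, S.card = 2 * q ∧ IsMinimalProductOne S := by
  have hq := (Fact.out : q.Prime).two_le
  obtain ⟨α, hα, hx⟩ := A.exists_translation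
  obtain ⟨τ, hτ⟩ := A.exists_χ_ne_one
  refine ⟨τ ::ₘ (α * τ⁻¹ * α) ::ₘ Multiset.replicate (2 * q - 2) α, ?_, by simp, ?_, ?_⟩
  · simp only [Multiset.card_cons, Multiset.card_replicate]
    omega
  · refine ⟨τ :: (List.replicate (q - 1) α ++ (α * τ⁻¹ * α) :: List.replicate (q - 1) α), ?_, ?_⟩
    · rw [← Multiset.cons_coe, Multiset.cons_inj_right, ← Multiset.coe_replicate,
        Multiset.cons_coe, Multiset.coe_eq_coe]
      refine List.perm_middle.trans (List.Perm.cons _ ?_)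
      rw [← List.replicate_add]
      exact List.Perm.of_eq (by congr 1; omega)
    · have h1 : α ^ q = 1 := (A.translation_pow_eq_one_iff hα hx q).2 dvd_rfl
      have h2 : α ^ (q - 1) * α = 1 := by rw [← pow_succ, Nat.sub_add_cancel (by omega), h1]
      have h3 : α * α ^ (q - 1) = 1 := by rw [← pow_succ', Nat.sub_add_cancel (by omega), h1]
      rw [List.prod_cons, List.prod_append, List.prod_cons, List.prod_replicate]
      simp only [mul_assoc]
      rw [h3, mul_one, ← mul_assoc (α ^ (q - 1)), h2, one_mul, mul_inv_cancel]
  · rintro ⟨T₁, T₂, h1, h2, hS, hT₁, hT₂⟩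
    wlog hmem : τ ∈ T₁ generalizing T₁ T₂
    · have hadd : τ ∈ T₁ + T₂ := by
        rw [← hS]
        simp
      exact this T₂ T₁ h2 h1 (by rw [hS, add_comm]) hT₂ hT₁
        ((Multiset.mem_add.1 hadd).resolve_left hmem)
    obtain ⟨U, rfl⟩ := Multiset.exists_cons_of_mem hmem
    rw [Multiset.cons_add, Multiset.cons_inj_right] at hS
    have hmem' : α * τ⁻¹ * α ∈ U + T₂ := by
      rw [← hS]
      simp
    rcases Multiset.mem_add.1 hmem' with hmem' | hmem'
    · obtain ⟨U', rfl⟩ := Multiset.exists_cons_of_mem hmem'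
      rw [Multiset.cons_add, Multiset.cons_inj_right] at hS
      obtain ⟨i, j, hij, rfl, rfl⟩ := Multiset.eq_replicate_of_add_eq hS
      obtain ⟨l, hl, hl1⟩ := hT₂
      rw [← Multiset.coe_replicate, Multiset.coe_eq_coe, List.perm_replicate] at hl
      rw [hl, List.prod_replicate, A.translation_pow_eq_one_iff hα hx] at hl1
      obtain ⟨m, rfl⟩ := hl1
      have hm : m = 1 := by
        rcases m with _ | _ | m
        · simp at h2
        · rfl
        · nlinarith [Nat.zero_le (q * m), Nat.sub_lt (by omega : 0 < 2 * q) (by omega : 0 < 2)]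
      obtain rfl : i = q - 2 := by
        subst hm
        omega
      exact A.not_isProductOne_pair_add_replicate hα hx hτ hT₁
    · obtain ⟨U', rfl⟩ := Multiset.exists_cons_of_mem hmem'
      rw [Multiset.add_cons, Multiset.cons_inj_right] at hS
      obtain ⟨i, j, hij, rfl, rfl⟩ := Multiset.eq_replicate_of_add_eq hS
      have := (A.isProductOne_iff.1 hT₁).1
      simp [lin, hα, hτ] at this

end AffineCoords

theorem stmt6 (p q : ℕ) (hp : p.Prime) (hq : q.Prime) (hpq : p ∣ q - 1)
    (G : Type*) [Group G] [Finite G] (hG : Nat.card G = p * q)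
    (hna : ¬ ∀ a b : G, a * b = b * a) :
    largeDavenport G = 2 * q := by
  have : Fact q.Prime := ⟨hq⟩
  have hle := Nat.le_of_dvd (Nat.sub_pos_of_lt hq.one_lt) hpq
  have hlt : p < q := by
    have := hq.two_le
    omega
  obtain ⟨A⟩ := AffineCoords.nonempty_of_card hp hlt hG hna
  obtain ⟨S, hS⟩ := A.exists_isMinimalProductOne
  have hub : ∀ n ∈ {n | ∃ S : Multiset G, Multiset.card S = n ∧ IsMinimalProductOne S},
      n ≤ 2 * q := by
    rintro n ⟨T, rfl, hT⟩
    by_cases hp2 : p = 2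
    · have := hT.card_le_of_mem ⊤ fun g _ => Submonoid.mem_top g
      rwa [Nat.card_congr Submonoid.topEquiv.toEquiv, hG, hp2] at this
    · refine A.card_le_two_mul hp hp2 ?_ hpq hT
      obtain ⟨k, hk⟩ := hpq
      obtain ⟨m, hm⟩ := hp.odd_of_ne_two hp2
      rcases k with _ | _ | k
      · have := hp.two_le
        omega
      · obtain ⟨n, hn⟩ := hq.odd_of_ne_two (by have := hp.two_le; omega)
        omega
      · have := hp.two_le
        have : p * 2 ≤ p * (k + 1 + 1) := Nat.mul_le_mul le_rfl (by omega)
        omega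
  exact le_antisymm (csSup_le' hub) (le_csSup ⟨2 * q, hub⟩ ⟨S, hS⟩)
end

section
/- Let p and q be primes with p dividing q−1, and let G be a finite non-abelian group of order pq (the group F_pq). Then D(G) ≥ 2q. -/
/-- A minimal product-one sequence over a finite group has at most as many terms as the group
has elements: two coinciding prefix products of an ordering with product one split it. -/
theorem IsMinimalProductOne.card_le {G : Type*} [Group G] [Finite G] {S : Multiset G}
    (h : IsMinimalProductOne S) : Multiset.card S ≤ Nat.card G := by
  obtain ⟨-, ⟨l, rfl, hl⟩, hmin⟩ := h
  by_contra! hlt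
  rw [Multiset.coe_card] at hlt
  obtain ⟨i, j, hne, hij⟩ : ∃ i j : Fin l.length, i ≠ j ∧ (l.take i).prod = (l.take j).prod := by
    by_contra! hinj
    have := Nat.card_le_card_of_injective (fun i : Fin l.length => (l.take i).prod)
      fun i j hij => by_contra fun hne => hinj i j hne hij
    simp only [Nat.card_fin] at this
    omega
  wlog hlt : i < j generalizing i j
  · exact this j i hne.symm hij.symm (lt_of_le_of_ne (not_lt.mp hlt) hne.symm)
  have hlt : (i : ℕ) < j := hlt
  have hsplit : l.take j = l.take i ++ (l.take j).drop i := by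
    conv_lhs => rw [← List.take_append_drop i (l.take j)]
    rw [List.take_take, min_eq_left hlt.le]
  have hseg : ((l.take j).drop i).prod = 1 := by
    have := congrArg List.prod hsplit
    rw [List.prod_append, hij] at this
    exact left_eq_mul.mp this
  refine hmin ⟨((l.take j).drop i : List G), (l.take i ++ l.drop j : List G), ?_, ?_, ?_,
    ⟨_, rfl, hseg⟩, ⟨_, rfl, ?_⟩⟩
  · intro h0
    have := congrArg Multiset.card h0
    simp only [Multiset.coe_card, List.length_drop, List.length_take, Multiset.card_zero] at this
    omega
  · intro h0
    have := congrArg Multiset.card h0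
    simp only [Multiset.coe_card, List.length_append, List.length_drop, List.length_take,
      Multiset.card_zero] at this
    omega
  · rw [Multiset.coe_add, Multiset.coe_eq_coe]
    conv_lhs => rw [← List.take_append_drop j l, hsplit]
    rw [← List.append_assoc]
    exact List.perm_append_comm.append_right _
  · rw [List.prod_append, hij, ← List.prod_append, List.take_append_drop, hl]

theorem bddAbove_card_isMinimalProductOne (G : Type*) [Group G] [Finite G] :
    BddAbove {n | ∃ S : Multiset G, Multiset.card S = n ∧ IsMinimalProductOne S} := by
  refine ⟨Nat.card G, ?_⟩
  rintro _ ⟨S, rfl, hS⟩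
  exact hS.card_le

theorem List.exists_append_of_coe_eq_cons {α : Type*} {l : List α} {x : α} {S : Multiset α}
    (h : (l : Multiset α) = x ::ₘ S) :
    ∃ l₁ l₂ : List α, l = l₁ ++ x :: l₂ ∧ ((l₁ ++ l₂ : List α) : Multiset α) = S := by
  have hx : x ∈ l := by
    rw [← Multiset.mem_coe, h]
    exact Multiset.mem_cons_self x S
  obtain ⟨l₁, l₂, rfl⟩ := List.append_of_mem hx
  refine ⟨l₁, l₂, rfl, ?_⟩
  rw [Multiset.coe_eq_coe.mpr List.perm_middle, ← Multiset.cons_coe] at h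
  exact (Multiset.cons_inj_right x).mp h

/-- A product-one sequence can be ordered so that its product is one and a given term is last. -/
theorem IsProductOne.exists_prod_mul_eq_one {G : Type*} [Group G] {x : G} {S : Multiset G}
    (h : IsProductOne (x ::ₘ S)) : ∃ l : List G, (l : Multiset G) = S ∧ l.prod * x = 1 := by
  obtain ⟨l, hl, hprod⟩ := h
  obtain ⟨l₁, l₂, rfl, hS⟩ := List.exists_append_of_coe_eq_cons hl
  refine ⟨l₂ ++ l₁, ?_, ?_⟩
  · rw [← hS, Multiset.coe_eq_coe]
    exact List.perm_append_comm
  · rw [List.prod_append, List.prod_cons] at hprod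
    rw [List.prod_append, mul_assoc, mul_eq_one_comm, mul_assoc, hprod]

theorem IsProductOne.pow_mul_eq_one {G : Type*} [Group G] {a x : G} {n : ℕ}
    (h : IsProductOne (x ::ₘ Multiset.replicate n a)) : a ^ n * x = 1 := by
  obtain ⟨l, hl, hprod⟩ := h.exists_prod_mul_eq_one
  rwa [List.perm_replicate.mp (Multiset.coe_eq_coe.mp hl), List.prod_replicate] at hprod

theorem IsProductOne.exists_pow_mul_eq_one {G : Type*} [Group G] {a x y : G} {n : ℕ}
    (h : IsProductOne (y ::ₘ x ::ₘ Multiset.replicate n a)) :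
    ∃ i j, i + j = n ∧ a ^ i * x * a ^ j * y = 1 := by
  obtain ⟨l, hl, hprod⟩ := h.exists_prod_mul_eq_one
  obtain ⟨l₁, l₂, rfl, hrest⟩ := List.exists_append_of_coe_eq_cons hl
  have hrep := List.append_eq_replicate_iff.mp (List.perm_replicate.mp (Multiset.coe_eq_coe.mp hrest))
  refine ⟨l₁.length, l₂.length, hrep.1, ?_⟩
  rw [List.prod_append, List.prod_cons, hrep.2.1, hrep.2.2, List.prod_replicate,
    List.prod_replicate] at hprod
  rwa [mul_assoc (a ^ _)]

/-- If `a` has prime order `q` and `t` does not commute with `a`, then the sequence with terms `t`,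
`a * t⁻¹ * a` and `2 * q - 2` copies of `a` is a minimal product-one sequence. -/
theorem isMinimalProductOne_cons_cons_replicate {G : Type*} [Group G] {q : ℕ} (hq : q.Prime)
    {a t : G} (ha : orderOf a = q) (hat : ¬ Commute t a) :
    IsMinimalProductOne ((a * t⁻¹ * a) ::ₘ t ::ₘ Multiset.replicate (2 * q - 2) a) := by
  have hq2 := hq.two_le
  have haq : a ^ q = 1 := ha ▸ pow_orderOf_eq_one a
  have ht (n : ℕ) : ¬ IsProductOne (t ::ₘ Multiset.replicate n a) := fun h => hat <| by
    rw [eq_inv_of_mul_eq_one_right h.pow_mul_eq_one]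
    exact ((Commute.refl a).pow_left n).inv_left
  have htu : ¬ IsProductOne ((a * t⁻¹ * a) ::ₘ t ::ₘ Multiset.replicate (q - 2) a) := by
    intro h
    obtain ⟨i, j, hij, h1⟩ := h.exists_pow_mul_eq_one
    have h2 : a ^ (i + 1) * (t * a ^ (j + 1) * t⁻¹) = 1 := by
      rw [← mul_assoc, ← mul_assoc, mul_eq_one_comm] at h1
      rw [← h1]
      rw [pow_succ' a i, pow_succ a j]
      simp only [mul_assoc]
    have h3 : a ^ (i + 1) * a ^ (j + 1) = 1 := by
      rw [← pow_add, ← haq]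
      congr 1
      omega
    have h4 : Commute t (a ^ (j + 1)) := by
      have := mul_left_cancel (h2.trans h3.symm)
      exact mul_inv_eq_iff_eq_mul.mp this
    have hcop : (orderOf a).Coprime (j + 1) := by
      rw [ha]
      exact Nat.coprime_of_lt_prime (by omega) (by omega) hq
    obtain ⟨m, hm⟩ := exists_pow_eq_self_of_coprime hcop.symm
    exact hat (hm ▸ h4.pow_right m)
  refine ⟨Multiset.cons_ne_zero, ?_, ?_⟩
  · refine ⟨List.replicate (q - 1) a ++ t :: (List.replicate (q - 1) a ++ [a * t⁻¹ * a]), ?_, ?_⟩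
    · have h2q : 2 * q - 2 = (q - 1) + (q - 1) := by omega
      rw [Multiset.coe_eq_coe.mpr List.perm_middle, ← Multiset.cons_coe, ← List.append_assoc,
        List.replicate_append_replicate, ← h2q, Multiset.coe_eq_coe.mpr List.perm_append_comm,
        List.singleton_append, ← Multiset.cons_coe, Multiset.coe_replicate, Multiset.cons_swap]
    · have h1 : a ^ (q - 1) * a = 1 := by
        rw [← pow_succ, Nat.sub_add_cancel (by omega), haq]
      simp only [List.prod_append, List.prod_cons, List.prod_replicate, List.prod_nil, mul_one]
      rw [mul_assoc a, ← mul_assoc _ a, h1, one_mul, mul_inv_cancel_left, h1]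
  · rintro ⟨T₁, T₂, hT₁, hT₂, hS, h₁, h₂⟩
    have hmem : t ∈ T₁ + T₂ := hS ▸ by simp
    wlog htT : t ∈ T₁ generalizing T₁ T₂
    · exact this T₂ T₁ hT₂ hT₁ (by rw [hS, add_comm]) h₂ h₁ (by rwa [add_comm])
        ((Multiset.mem_add.mp hmem).resolve_left htT)
    obtain ⟨T, rfl⟩ := Multiset.exists_cons_of_mem htT
    rw [Multiset.cons_swap, Multiset.cons_add, Multiset.cons_inj_right] at hS
    have humem : a * t⁻¹ * a ∈ T + T₂ := hS ▸ Multiset.mem_cons_self _ _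
    rcases Multiset.mem_add.mp humem with huT | huT
    · obtain ⟨T', rfl⟩ := Multiset.exists_cons_of_mem huT
      rw [Multiset.cons_add, Multiset.cons_inj_right] at hS
      have hcard := congrArg Multiset.card hS
      have hT' := Multiset.eq_replicate_card.mpr fun b hb =>
        Multiset.eq_of_mem_replicate (hS ▸ Multiset.mem_add.mpr (Or.inl hb))
      have hT₂' := Multiset.eq_replicate_card.mpr fun b hb =>
        Multiset.eq_of_mem_replicate (hS ▸ Multiset.mem_add.mpr (Or.inr hb))
      rw [Multiset.card_replicate, Multiset.card_add] at hcard
      have hpos := Multiset.card_pos.mpr hT₂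
      obtain ⟨l, hl, hprod⟩ := h₂
      rw [hT₂'] at hl
      rw [List.perm_replicate.mp (Multiset.coe_eq_coe.mp hl), List.prod_replicate] at hprod
      obtain ⟨c, hc⟩ := ha ▸ orderOf_dvd_of_pow_eq_one hprod
      have hc1 : c = 1 := by
        have : 0 < c := Nat.pos_of_ne_zero (by rintro rfl; omega)
        have : c < 2 := by
          by_contra! hc2
          have := Nat.mul_le_mul_left q hc2
          omega
        omega
      subst hc1
      have hT'card : Multiset.card T' = q - 2 := by omega
      rw [hT', hT'card, Multiset.cons_swap] at h₁
      exact htu h₁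
    · obtain ⟨T', rfl⟩ := Multiset.exists_cons_of_mem huT
      rw [Multiset.add_cons, Multiset.cons_inj_right] at hS
      have hT := Multiset.eq_replicate_card.mpr fun b hb =>
        Multiset.eq_of_mem_replicate (hS ▸ Multiset.mem_add.mpr (Or.inl hb))
      rw [hT] at h₁
      exact ht _ h₁

theorem exists_orderOf_eq_and_not_commute {G : Type*} [Group G] {p q : ℕ} (hp : p.Prime)
    (hq : q.Prime) (hG : Nat.card G = p * q) (hna : ¬ ∀ a b : G, a * b = b * a) :
    ∃ a t : G, orderOf a = q ∧ ¬ Commute t a := by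
  have : Finite G := Nat.finite_of_card_ne_zero (hG ▸ mul_ne_zero hp.ne_zero hq.ne_zero)
  have : Fact q.Prime := ⟨hq⟩
  have : Fact p.Prime := ⟨hp⟩
  obtain ⟨a, ha⟩ := exists_prime_orderOf_dvd_card' (G := G) q (hG ▸ dvd_mul_left q p)
  refine ⟨a, ?_⟩
  by_contra! hcomm
  have hcenter : a ∈ Subgroup.center G := Subgroup.mem_center_iff.mpr fun t => hcomm t ha
  have hdvd : q ∣ Nat.card (Subgroup.center G) := ha ▸ Subgroup.orderOf_dvd_natCard _ hcenter
  have hindex : (Subgroup.center G).index ∣ p := by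
    obtain ⟨c, hc⟩ := hdvd
    have := (Subgroup.center G).card_mul_index
    rw [hc, hG, mul_comm p, mul_assoc] at this
    exact ⟨c, by rw [← Nat.eq_of_mul_eq_mul_left hq.pos this, mul_comm]⟩
  have hcyc : IsCyclic (G ⧸ Subgroup.center G) := isCyclic_of_card_dvd_prime hindex
  exact hna ((QuotientGroup.mk' (Subgroup.center G)).isMulCommutative_of_isCyclic_of_ker_le_center
    (by simp)).is_comm.comm

theorem stmt7 (p q : ℕ) (hp : p.Prime) (hq : q.Prime) (hpq : p ∣ q - 1)
    (G : Type*) [Group G] [Finite G] (hG : Nat.card G = p * q)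
    (hna : ¬ ∀ a b : G, a * b = b * a) :
    2 * q ≤ largeDavenport G := by
  obtain ⟨a, t, ha, hat⟩ := exists_orderOf_eq_and_not_commute hp hq hG hna
  refine le_csSup (bddAbove_card_isMinimalProductOne G)
    ⟨_, ?_, isMinimalProductOne_cons_cons_replicate hq ha hat⟩
  have := hq.two_le
  rw [Multiset.card_cons, Multiset.card_cons, Multiset.card_replicate]
  omega
end
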